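/- arXiv:1702.04608 — 5 statements merged into one kernel-verified Lean document; each statement's English description precedes it below -/
import Mathlib

section
/- Let Q be a connected graph with at least two vertices and let u be a vertex of Q. For an integer a ≥ 1, let G₁ be the tree-like graph obtained from Q by taking a star S_{a+1} with center v and joining v to u by an edge, and let G₂ be the graph obtained from Q by attaching a+1 pendant vertices to u. Then ξ^{ce}(G₂) ≥ ξ^{ce}(G₁). -/
open Finset SimpleGraph

variable {V : Type*}

open Classical in
/-- The degree of a vertex `u` in a graph `G` (number of neighbors). -/
noncomputable def deg [Fintype V] (G : SimpleGraph V) (u : V) : ℕ :=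
  (Finset.univ.filter (fun v => G.Adj u v)).card

/-- The eccentricity of a vertex `u`: the maximum distance from `u` to any vertex. -/
noncomputable def ecc [Fintype V] (G : SimpleGraph V) (u : V) : ℕ :=
  Finset.univ.sup (fun v => G.dist u v)

/-- The connective eccentricity index `ξ^{ce}(G) = Σ_{u ∈ V} d(u)/ε(u)`. -/
noncomputable def cei [Fintype V] (G : SimpleGraph V) : ℝ :=
  ∑ u : V, (deg G u : ℝ) / (ecc G u)

/-- `G₁`: attach a star `S_{a+1}` (center `v = Sum.inr 0`, leaves `Sum.inr j`, `j ≠ 0`)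
at its center `v` to the vertex `u` of `Q` by an edge. -/
def attachStarAtCenter (Q : SimpleGraph V) (u : V) (a : ℕ) :
    SimpleGraph (V ⊕ Fin (a + 1)) :=
  SimpleGraph.fromRel (fun x y =>
    (∃ p q, x = Sum.inl p ∧ y = Sum.inl q ∧ Q.Adj p q) ∨
    (x = Sum.inl u ∧ y = Sum.inr 0) ∨
    (∃ j : Fin (a + 1), j ≠ 0 ∧ x = Sum.inr 0 ∧ y = Sum.inr j))

/-- `G₂`: attach `a + 1` pendant vertices to the vertex `u` of `Q`. -/
def attachPendants (Q : SimpleGraph V) (u : V) (a : ℕ) :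
    SimpleGraph (V ⊕ Fin (a + 1)) :=
  SimpleGraph.fromRel (fun x y =>
    (∃ p q, x = Sum.inl p ∧ y = Sum.inl q ∧ Q.Adj p q) ∨
    (∃ j : Fin (a + 1), x = Sum.inl u ∧ y = Sum.inr j))

section Adjacency

variable {Q : SimpleGraph V} {u : V} {a : ℕ}

@[simp]
theorem attachStarAtCenter_adj_inl_inl {p q : V} :
    (attachStarAtCenter Q u a).Adj (.inl p) (.inl q) ↔ Q.Adj p q := by
  simp only [attachStarAtCenter, SimpleGraph.fromRel_adj]
  have := Q.adj_comm p q
  have := Q.ne_of_adj (a := p) (b := q)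
  simp
  tauto

@[simp]
theorem attachStarAtCenter_adj_inl_inr {p : V} {j : Fin (a + 1)} :
    (attachStarAtCenter Q u a).Adj (.inl p) (.inr j) ↔ p = u ∧ j = 0 := by
  simp [attachStarAtCenter, SimpleGraph.fromRel_adj]

@[simp]
theorem attachStarAtCenter_adj_inr_inl {p : V} {j : Fin (a + 1)} :
    (attachStarAtCenter Q u a).Adj (.inr j) (.inl p) ↔ p = u ∧ j = 0 := by
  rw [SimpleGraph.adj_comm, attachStarAtCenter_adj_inl_inr]

@[simp]
theorem attachStarAtCenter_adj_inr_inr {i j : Fin (a + 1)} :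
    (attachStarAtCenter Q u a).Adj (.inr i) (.inr j) ↔ (i = 0 ∧ j ≠ 0) ∨ (j = 0 ∧ i ≠ 0) := by
  simp [attachStarAtCenter, SimpleGraph.fromRel_adj]
  grind

@[simp]
theorem attachPendants_adj_inl_inl {p q : V} :
    (attachPendants Q u a).Adj (.inl p) (.inl q) ↔ Q.Adj p q := by
  simp only [attachPendants, SimpleGraph.fromRel_adj]
  have := Q.adj_comm p q
  have := Q.ne_of_adj (a := p) (b := q)
  simp
  tauto

@[simp]
theorem attachPendants_adj_inl_inr {p : V} {j : Fin (a + 1)} :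
    (attachPendants Q u a).Adj (.inl p) (.inr j) ↔ p = u := by
  simp [attachPendants, SimpleGraph.fromRel_adj]

@[simp]
theorem attachPendants_adj_inr_inl {p : V} {j : Fin (a + 1)} :
    (attachPendants Q u a).Adj (.inr j) (.inl p) ↔ p = u := by
  rw [SimpleGraph.adj_comm, attachPendants_adj_inl_inr]

@[simp]
theorem attachPendants_adj_inr_inr {i j : Fin (a + 1)} :
    ¬ (attachPendants Q u a).Adj (.inr i) (.inr j) := by
  simp [attachPendants, SimpleGraph.fromRel_adj]

end Adjacency

section Metric

variable {Q : SimpleGraph V} (u : V) (a : ℕ)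

theorem attachStarAtCenter_connected (hQ : Q.Connected) :
    (attachStarAtCenter Q u a).Connected := by
  have center : (attachStarAtCenter Q u a).Adj (.inl u) (.inr 0) := by simp
  refine SimpleGraph.connected_iff_exists_forall_reachable _ |>.2 ⟨.inl u, ?_⟩
  rintro (q | j)
  · exact (hQ.preconnected u q).map (⟨Sum.inl, by simp⟩ : Q →g attachStarAtCenter Q u a)
  · by_cases hj : j = 0
    · exact hj ▸ center.reachable
    · refine center.reachable.trans (SimpleGraph.Adj.reachable ?_)
      simp [hj]

theorem attachPendants_connected (hQ : Q.Connected) : (attachPendants Q u a).Connected := by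
  refine SimpleGraph.connected_iff_exists_forall_reachable _ |>.2 ⟨.inl u, ?_⟩
  rintro (q | j)
  · exact (hQ.preconnected u q).map (⟨Sum.inl, by simp⟩ : Q →g attachPendants Q u a)
  · exact SimpleGraph.Adj.reachable (by simp)

/-- A function that grows by at most one along each edge grows by at most the distance. -/
theorem SimpleGraph.Connected.le_add_dist {W : Type*} {G : SimpleGraph W} (hG : G.Connected)
    {g : W → ℕ} (hg : ∀ x y, G.Adj x y → g y ≤ g x + 1) (x y : W) :
    g y ≤ g x + G.dist x y := by
  obtain ⟨w, hw⟩ := hG.exists_walk_length_eq_dist x y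
  rw [← hw]
  clear hw
  induction w with
  | nil => simp
  | cons h w ih =>
    have := hg _ _ h
    rw [SimpleGraph.Walk.length_cons]
    omega

/-- A lower bound for the distance from `Sum.inl p` in `attachStarAtCenter Q u a`. -/
noncomputable def starDistBound (Q : SimpleGraph V) (u p : V) (a : ℕ) : V ⊕ Fin (a + 1) → ℕ
  | .inl q => Q.dist p q
  | .inr j => Q.dist p u + if j = 0 then 1 else 2

theorem starDistBound_le_dist (hQ : Q.Connected) (p : V) (y : V ⊕ Fin (a + 1)) :
    starDistBound Q u p a y ≤ (attachStarAtCenter Q u a).dist (.inl p) y := by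
  have := (attachStarAtCenter_connected u a hQ).le_add_dist (g := starDistBound Q u p a) ?_
    (.inl p) y
  · simpa [starDistBound] using this
  · rintro (q | i) (r | j) h
    · have hadj : Q.Adj q r := by simpa using h
      have := hQ.dist_triangle (u := p) (v := q) (w := r)
      rw [SimpleGraph.dist_eq_one_iff_adj.2 hadj] at this
      exact this
    · obtain ⟨rfl, rfl⟩ : q = u ∧ j = 0 := by simpa using h
      simp [starDistBound]
    · obtain ⟨rfl, rfl⟩ : r = u ∧ i = 0 := by simpa using h
      simp [starDistBound]
      omega
    · simp only [starDistBound]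
      split_ifs <;> simp_all

theorem attachPendants_dist_inl_inl_le (hQ : Q.Connected) (p q : V) :
    (attachPendants Q u a).dist (.inl p) (.inl q) ≤ Q.dist p q := by
  obtain ⟨w, hw⟩ := hQ.exists_walk_length_eq_dist p q
  rw [← hw, ← w.length_map (⟨Sum.inl, by simp⟩ : Q →g attachPendants Q u a)]
  exact SimpleGraph.dist_le _

theorem attachPendants_dist_inl_inr_le (hQ : Q.Connected) (p : V) (j : Fin (a + 1)) :
    (attachPendants Q u a).dist (.inl p) (.inr j) ≤ Q.dist p u + 1 := by
  have htri := (attachPendants_connected u a hQ).dist_triangle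
    (u := .inl p) (v := .inl u) (w := .inr j)
  have hadj : (attachPendants Q u a).Adj (.inl u) (.inr j) := by simp
  rw [SimpleGraph.dist_eq_one_iff_adj.2 hadj] at htri
  have := attachPendants_dist_inl_inl_le u a hQ p u
  omega

theorem attachPendants_dist_inr_inr_le (hQ : Q.Connected) (i j : Fin (a + 1)) :
    (attachPendants Q u a).dist (.inr i) (.inr j) ≤ 2 := by
  have htri := (attachPendants_connected u a hQ).dist_triangle
    (u := .inr i) (v := .inl u) (w := .inr j)
  have hi : (attachPendants Q u a).Adj (.inr i) (.inl u) := by simp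
  have hj : (attachPendants Q u a).Adj (.inl u) (.inr j) := by simp
  rwa [SimpleGraph.dist_eq_one_iff_adj.2 hi, SimpleGraph.dist_eq_one_iff_adj.2 hj] at htri

end Metric

section Eccentricity

theorem dist_le_ecc [Fintype V] (G : SimpleGraph V) (x y : V) : G.dist x y ≤ ecc G x :=
  Finset.le_sup (f := fun v => G.dist x v) (Finset.mem_univ y)

theorem ecc_le_iff [Fintype V] {G : SimpleGraph V} {x : V} {n : ℕ} :
    ecc G x ≤ n ↔ ∀ y, G.dist x y ≤ n := by
  simp [ecc]

theorem ecc_pos [Fintype V] [Nontrivial V] {G : SimpleGraph V} (hG : G.Connected) (x : V) :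
    0 < ecc G x := by
  obtain ⟨y, hy⟩ := exists_ne x
  exact (hG.pos_dist_of_ne hy.symm).trans_le (dist_le_ecc G x y)

variable [Fintype V] {Q : SimpleGraph V} (u : V) {a : ℕ}

theorem ecc_attachPendants_le_ecc_attachStarAtCenter [Nontrivial V] (hQ : Q.Connected)
    (x : V ⊕ Fin (a + 1)) :
    ecc (attachPendants Q u a) x ≤ ecc (attachStarAtCenter Q u a) x := by
  rw [ecc_le_iff]
  rcases x with p | i
  · rintro (q | j)
    · exact (attachPendants_dist_inl_inl_le u a hQ p q).trans
        ((starDistBound_le_dist u a hQ p (.inl q)).trans (dist_le_ecc _ _ _))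
    · have lower := starDistBound_le_dist u a hQ p (.inr j)
      have upper := attachPendants_dist_inl_inr_le u a hQ p j
      have := dist_le_ecc (attachStarAtCenter Q u a) (.inl p) (.inr j)
      simp only [starDistBound] at lower
      split_ifs at lower <;> omega
  · have key (q : V) : Q.dist q u + 1 ≤ ecc (attachStarAtCenter Q u a) (.inr i) := by
      have lower := starDistBound_le_dist u a hQ q (.inr i)
      rw [SimpleGraph.dist_comm] at lower
      have := dist_le_ecc (attachStarAtCenter Q u a) (.inr i) (.inl q)
      simp only [starDistBound] at lower
      split_ifs at lower <;> omega
    rintro (q | j)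
    · rw [SimpleGraph.dist_comm]
      exact (attachPendants_dist_inl_inr_le u a hQ q i).trans (key q)
    · obtain ⟨q, hq⟩ := exists_ne u
      have := hQ.pos_dist_of_ne hq
      have := key q
      have := attachPendants_dist_inr_inr_le u a hQ i j
      omega

theorem ecc_attachPendants_root_le_ecc_attachStarAtCenter_center (hQ : Q.Connected) :
    ecc (attachPendants Q u a) (.inl u) ≤ ecc (attachStarAtCenter Q u a) (.inr 0) := by
  have key (q : V) : Q.dist q u + 1 ≤ ecc (attachStarAtCenter Q u a) (.inr 0) := by
    have lower := starDistBound_le_dist u a hQ q (.inr 0)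
    rw [SimpleGraph.dist_comm] at lower
    exact lower.trans (dist_le_ecc _ _ _)
  rw [ecc_le_iff]
  rintro (q | j)
  · have := attachPendants_dist_inl_inl_le u a hQ u q
    have := key q
    rw [SimpleGraph.dist_comm (u := q)] at this
    omega
  · exact (attachPendants_dist_inl_inr_le u a hQ u j).trans (key u)

end Eccentricity

section Degree

variable [Fintype V] (Q : SimpleGraph V) (u : V) (a : ℕ)

theorem deg_eq_ncard (p : V) : deg Q p = {q | Q.Adj p q}.ncard := by
  classical
  simp only [deg, Set.ncard_eq_toFinset_card', Set.toFinset_ofPred]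

theorem deg_eq_ncard_inl_add_ncard_inr {W : Type*} [Fintype W] (G : SimpleGraph (V ⊕ W))
    (x : V ⊕ W) :
    deg G x = {q | G.Adj x (.inl q)}.ncard + {j | G.Adj x (.inr j)}.ncard := by
  classical
  simp only [deg, Finset.card_filter, Fintype.sum_sum_type, Set.ncard_eq_toFinset_card',
    Set.toFinset_ofPred]

theorem deg_attachStarAtCenter_inl_of_ne {p : V} (hp : p ≠ u) :
    deg (attachStarAtCenter Q u a) (.inl p) = deg Q p := by
  simp [deg_eq_ncard_inl_add_ncard_inr, deg_eq_ncard Q, hp]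

theorem deg_attachStarAtCenter_root :
    deg (attachStarAtCenter Q u a) (.inl u) = deg Q u + 1 := by
  simp [deg_eq_ncard_inl_add_ncard_inr, deg_eq_ncard Q]

theorem deg_attachStarAtCenter_center :
    deg (attachStarAtCenter Q u a) (.inr 0) = a + 1 := by
  have leaves : {j : Fin (a + 1) | j ≠ 0}.ncard = a := by
    have := Set.ncard_compl ({0} : Set (Fin (a + 1)))
    simpa [Set.compl_def] using this
  simp only [ne_eq] at leaves
  simp [deg_eq_ncard_inl_add_ncard_inr, leaves, add_comm]

theorem deg_attachStarAtCenter_leaf (j : Fin a) :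
    deg (attachStarAtCenter Q u a) (.inr j.succ) = 1 := by
  simp [deg_eq_ncard_inl_add_ncard_inr]

theorem deg_attachPendants_inl_of_ne {p : V} (hp : p ≠ u) :
    deg (attachPendants Q u a) (.inl p) = deg Q p := by
  simp [deg_eq_ncard_inl_add_ncard_inr, deg_eq_ncard Q, hp]

theorem deg_attachPendants_root :
    deg (attachPendants Q u a) (.inl u) = deg Q u + (a + 1) := by
  simp [deg_eq_ncard_inl_add_ncard_inr, deg_eq_ncard Q]

theorem deg_attachPendants_inr (j : Fin (a + 1)) :
    deg (attachPendants Q u a) (.inr j) = 1 := by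
  simp [deg_eq_ncard_inl_add_ncard_inr]

end Degree

/-- Transformation A: `ξ^{ce}(G₂) ≥ ξ^{ce}(G₁)`. -/
theorem cei_attachPendants_ge_attachStar [Fintype V]
    (Q : SimpleGraph V) (hQ : Q.Connected) (hcard : 2 ≤ Fintype.card V)
    (u : V) (a : ℕ) (ha : 1 ≤ a) :
    cei (attachStarAtCenter Q u a) ≤ cei (attachPendants Q u a) := by
  classical
  have : Nontrivial V := Fintype.one_lt_card_iff_nontrivial.1 hcard
  have : Nontrivial (V ⊕ Fin (a + 1)) := Sum.inl_injective.nontrivial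
  have pos (x) : (0 : ℝ) < ecc (attachPendants Q u a) x :=
    Nat.cast_pos.2 (ecc_pos (attachPendants_connected u a hQ) x)
  have mono (x) :
      (ecc (attachPendants Q u a) x : ℝ) ≤ ecc (attachStarAtCenter Q u a) x :=
    Nat.cast_le.2 (ecc_attachPendants_le_ecc_attachStarAtCenter u hQ x)
  have root_le_center : (ecc (attachPendants Q u a) (.inl u) : ℝ) ≤
      ecc (attachStarAtCenter Q u a) (.inr 0) :=
    Nat.cast_le.2 (ecc_attachPendants_root_le_ecc_attachStarAtCenter_center u hQ)
  simp only [cei, Fintype.sum_sum_type, Fin.sum_univ_succ, deg_attachStarAtCenter_center,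
    deg_attachStarAtCenter_leaf, deg_attachPendants_inr,
    Fintype.sum_eq_add_sum_compl u, deg_attachStarAtCenter_root, deg_attachPendants_root]
  have rest : ∑ p ∈ ({u}ᶜ : Finset V), (deg (attachStarAtCenter Q u a) (.inl p) : ℝ) /
        ecc (attachStarAtCenter Q u a) (.inl p) ≤
      ∑ p ∈ ({u}ᶜ : Finset V), (deg (attachPendants Q u a) (.inl p) : ℝ) /
        ecc (attachPendants Q u a) (.inl p) := by
    refine Finset.sum_le_sum fun p hp => ?_
    have hpu : p ≠ u := by simpa using hp
    rw [deg_attachStarAtCenter_inl_of_ne Q u a hpu, deg_attachPendants_inl_of_ne Q u a hpu]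
    exact div_le_div_of_nonneg_left (Nat.cast_nonneg _) (pos _) (mono _)
  have leaves : ∑ j : Fin a, ((1 : ℕ) : ℝ) / ecc (attachStarAtCenter Q u a) (.inr j.succ) ≤
      ∑ j : Fin a, ((1 : ℕ) : ℝ) / ecc (attachPendants Q u a) (.inr j.succ) :=
    Finset.sum_le_sum fun j _ =>
      div_le_div_of_nonneg_left (Nat.cast_nonneg _) (pos _) (mono _)
  have root := div_le_div_of_nonneg_left (Nat.cast_nonneg (α := ℝ) (deg Q u + 1))
    (pos (.inl u)) (mono (.inl u))
  have moved := div_le_div_of_nonneg_left (Nat.cast_nonneg (α := ℝ) a)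
    (pos (.inl u)) root_le_center
  have center := div_le_div_of_nonneg_left (Nat.cast_nonneg (α := ℝ) 1)
    (pos (.inr 0)) (mono (.inr 0))
  push_cast [add_div] at *
  linarith
end

section
/- For every tree T with n ≥ 6 vertices that is not isomorphic to the path P_n, one has ξ^{ce}(T) > ξ^{ce}(P_n); that is, among all trees on n vertices the path uniquely minimizes the connective eccentricity index. -/
open Finset SimpleGraph

variable {V : Type*}

/-- The sum of the reciprocal eccentricities of the path with `d` edges. -/
noncomputable def pathRecipSum (d : ℕ) : ℝ :=
  ∑ i ∈ range (d + 1), 1 / ((max i (d - i) : ℕ) : ℝ)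

/-- The degree of the `i`-th vertex of the path with `d ≥ 1` edges. -/
noncomputable def pathDeg (d i : ℕ) : ℝ :=
  2 - (if i = 0 then 1 else 0) - (if i = d then 1 else 0)

lemma sum_pathDeg_mul (d : ℕ) (f : ℕ → ℝ) :
    ∑ i ∈ range (d + 1), pathDeg d i * f i = 2 * ∑ i ∈ range (d + 1), f i - f 0 - f d := by
  simp [pathDeg, sub_mul, Finset.sum_sub_distrib, Finset.mul_sum]

lemma sum_pathDeg_div_max (d : ℕ) :
    ∑ i ∈ range (d + 1), pathDeg d i * (1 / ((max i (d - i) : ℕ) : ℝ)) =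
      2 * pathRecipSum d - 2 / d := by
  rw [sum_pathDeg_mul d (fun i => 1 / ((max i (d - i) : ℕ) : ℝ)), pathRecipSum]
  simp
  ring

lemma pathRecipSum_succ_lt {d : ℕ} (hd : 1 ≤ d) :
    pathRecipSum (d + 1) < pathRecipSum d + 1 / ((d + 1 : ℕ) : ℝ) := by
  have key : ∑ i ∈ range (d + 1), 1 / ((max i (d + 1 - i) : ℕ) : ℝ) < pathRecipSum d := by
    refine Finset.sum_lt_sum (fun i _ => ?_) ⟨0, by simp, ?_⟩
    · refine one_div_le_one_div_of_le ?_ ?_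
      · exact_mod_cast (by omega : 0 < max i (d - i))
      · exact_mod_cast (by omega : max i (d - i) ≤ max i (d + 1 - i))
    · refine one_div_lt_one_div_of_lt ?_ ?_
      · exact_mod_cast (by omega : 0 < max 0 (d - 0))
      · exact_mod_cast (by omega : max 0 (d - 0) < max 0 (d + 1 - 0))
  rw [pathRecipSum, Finset.sum_range_succ]
  simpa using key

lemma pathRecipSum_lt {d m : ℕ} (hd : 1 ≤ d) (hm : d < m) :
    2 * pathRecipSum m - 2 / m <
      2 * pathRecipSum d - 2 / d + 2 * ((m : ℝ) - d) / d := by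
  induction m, hm using Nat.le_induction with
  | base =>
    have h := pathRecipSum_succ_lt hd
    push_cast at h ⊢
    have e : (2 : ℝ) * ((d : ℝ) + 1 - d) / d = 2 / d := by ring
    have e' : (2 : ℝ) / (d + 1) = 2 * (1 / (d + 1)) := by ring
    rw [Nat.succ_eq_add_one, e]
    linarith
  | succ k hk ih =>
    have h := pathRecipSum_succ_lt (d := k) (by omega)
    have hdk : (2 : ℝ) / k ≤ 2 / d := by
      gcongr
      omega
    push_cast at h ⊢
    have e : (2 : ℝ) * ((k : ℝ) + 1 - d) / d = 2 * ((k : ℝ) - d) / d + 2 / d := by ring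
    have e' : (2 : ℝ) / (k + 1) = 2 * (1 / (k + 1)) := by ring
    rw [e]
    linarith

lemma pathGraph_le_length {n : ℕ} {i j : Fin n} (p : (pathGraph n).Walk i j) :
    (i : ℕ) ≤ j + p.length ∧ (j : ℕ) ≤ i + p.length := by
  induction p with
  | nil => simp
  | cons h p ih =>
    rw [pathGraph_adj] at h
    rw [Walk.length_cons]
    omega

lemma le_ecc [Fintype V] (G : SimpleGraph V) (u v : V) : G.dist u v ≤ ecc G u :=
  Finset.le_sup (f := fun v => G.dist u v) (mem_univ v)

lemma max_le_ecc_pathGraph (d : ℕ) (i : Fin (d + 1)) :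
    max (i : ℕ) (d - i) ≤ ecc (pathGraph (d + 1)) i := by
  have key (j : Fin (d + 1)) :
      (i : ℕ) ≤ j + ecc (pathGraph (d + 1)) i ∧ (j : ℕ) ≤ i + ecc (pathGraph (d + 1)) i := by
    obtain ⟨p, hp⟩ := (pathGraph_connected d).exists_walk_length_eq_dist i j
    have := pathGraph_le_length p
    have := le_ecc (pathGraph (d + 1)) i j
    omega
  have h0 := key 0
  have hd := key (Fin.last d)
  simp only [Fin.val_zero, Fin.val_last] at h0 hd
  omega

lemma deg_pathGraph_le {d : ℕ} (i : Fin (d + 1)) :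
    (deg (pathGraph (d + 1)) i : ℝ) ≤ pathDeg d i := by
  classical
  have hsub : ((univ.filter fun j => (pathGraph (d + 1)).Adj i j).image Fin.val) ⊆
      (if (i : ℕ) = 0 then ∅ else {(i : ℕ) - 1}) ∪ (if (i : ℕ) = d then ∅ else {(i : ℕ) + 1}) := by
    intro k hk
    simp only [mem_image, mem_filter, mem_univ, true_and, pathGraph_adj] at hk
    obtain ⟨j, hj, rfl⟩ := hk
    have := j.isLt
    rw [mem_union]
    rcases hj with hj | hj
    · right
      rw [if_neg (by omega)]
      simp [hj]
    · left
      rw [if_neg (by omega)]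
      simp only [mem_singleton]
      omega
  have hcard := (Finset.card_le_card hsub).trans (Finset.card_union_le _ _)
  rw [Finset.card_image_of_injective _ Fin.val_injective] at hcard
  have hdeg : deg (pathGraph (d + 1)) i ≤
      (if (i : ℕ) = 0 then 0 else 1) + (if (i : ℕ) = d then 0 else 1) := by
    refine le_trans (le_of_eq ?_) (hcard.trans (le_of_eq ?_))
    · unfold deg
      congr
    · split_ifs <;> simp
  have hdeg' : (deg (pathGraph (d + 1)) i : ℝ) ≤
      (if (i : ℕ) = 0 then 0 else 1) + (if (i : ℕ) = d then 0 else 1) := by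
    exact_mod_cast hdeg
  refine hdeg'.trans (le_of_eq ?_)
  unfold pathDeg
  split_ifs <;> norm_num

lemma cei_pathGraph_le {d : ℕ} (hd : 1 ≤ d) :
    cei (pathGraph (d + 1)) ≤ 2 * pathRecipSum d - 2 / d := by
  rw [← sum_pathDeg_div_max,
    Finset.sum_range (fun i => pathDeg d i * (1 / ((max i (d - i) : ℕ) : ℝ)))]
  refine Finset.sum_le_sum fun i _ => ?_
  rw [div_eq_mul_one_div]
  have hpos : 0 < max (i : ℕ) (d - i) := by omega
  have hdeg := deg_pathGraph_le i
  refine mul_le_mul hdeg (one_div_le_one_div_of_le ?_ ?_) (by positivity)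
    ((Nat.cast_nonneg _).trans hdeg)
  · exact_mod_cast hpos
  · exact_mod_cast max_le_ecc_pathGraph d i

namespace SimpleGraph

lemma IsTree.eq_of_dist_add_one_eq {T : SimpleGraph V} (hT : T.IsTree) {w a b c : V}
    (hb : T.Adj b a) (hc : T.Adj c a)
    (hdb : T.dist w a = T.dist w b + 1) (hdc : T.dist w a = T.dist w c + 1) : b = c := by
  obtain ⟨p, hp⟩ := hT.connected.exists_walk_length_eq_dist w b
  obtain ⟨q, hq⟩ := hT.connected.exists_walk_length_eq_dist w c
  have hp' := (p.concat hb).isPath_of_length_eq_dist (by rw [Walk.length_concat]; omega)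
  have hq' := (q.concat hc).isPath_of_length_eq_dist (by rw [Walk.length_concat]; omega)
  have h := congrArg Walk.penultimate ((hT.existsUnique_path w a).unique hp' hq')
  simpa using h

lemma Connected.exists_geodesic {G : SimpleGraph V} (hG : G.Connected) (u w : V) :
    ∃ v : ℕ → V, v 0 = u ∧ v (G.dist u w) = w ∧
      ∀ i < G.dist u w, G.Adj (v i) (v (i + 1)) := by
  obtain ⟨p, hp⟩ := hG.exists_walk_length_eq_dist u w
  refine ⟨p.getVert, by simp, by simp [← hp], fun i hi => p.adj_getVert_succ (by omega)⟩

section Geodesic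

variable {G : SimpleGraph V} {d : ℕ} {v : ℕ → V}

lemma Connected.dist_add_le (hG : G.Connected) (hadj : ∀ i < d, G.Adj (v i) (v (i + 1)))
    (i k : ℕ) (h : i + k ≤ d) : G.dist (v i) (v (i + k)) ≤ k := by
  induction k with
  | zero => simp
  | succ k ih =>
    have h1 := hG.dist_triangle (u := v i) (v := v (i + k)) (w := v (i + k + 1))
    have h2 := dist_eq_one_iff_adj.mpr (hadj (i + k) (by omega))
    have h3 := ih (by omega)
    rw [← add_assoc]
    omega

lemma Connected.dist_eq_sub (hG : G.Connected) (hadj : ∀ i < d, G.Adj (v i) (v (i + 1)))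
    (hd : G.dist (v 0) (v d) = d) {i j : ℕ} (hij : i ≤ j) (hj : j ≤ d) :
    G.dist (v i) (v j) = j - i := by
  obtain ⟨k, rfl⟩ := Nat.exists_eq_add_of_le hij
  obtain ⟨l, rfl⟩ := Nat.exists_eq_add_of_le hj
  have h1 := hG.dist_add_le hadj 0 i (by omega)
  have h2 := hG.dist_add_le hadj i k (by omega)
  have h3 := hG.dist_add_le hadj (i + k) l (by omega)
  have h4 := hG.dist_triangle (u := v 0) (v := v i) (w := v (i + k + l))
  have h5 := hG.dist_triangle (u := v i) (v := v (i + k)) (w := v (i + k + l))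
  rw [zero_add] at h1
  omega

lemma Connected.injOn_geodesic (hG : G.Connected) (hadj : ∀ i < d, G.Adj (v i) (v (i + 1)))
    (hd : G.dist (v 0) (v d) = d) : Set.InjOn v (range (d + 1)) := by
  intro i hi j hj hij
  simp only [coe_range, Set.mem_Iio] at hi hj
  rcases le_total i j with h | h
  · have := hG.dist_eq_sub hadj hd h (by omega)
    rw [hij, dist_self] at this
    omega
  · have := hG.dist_eq_sub hadj hd h (by omega)
    rw [hij, dist_self] at this
    omega

lemma Connected.adj_geodesic_iff (hG : G.Connected) (hadj : ∀ i < d, G.Adj (v i) (v (i + 1)))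
    (hd : G.dist (v 0) (v d) = d) {i j : ℕ} (hi : i ≤ d) (hj : j ≤ d) :
    G.Adj (v i) (v j) ↔ i + 1 = j ∨ j + 1 = i := by
  rw [← dist_eq_one_iff_adj]
  rcases le_total i j with h | h
  · rw [hG.dist_eq_sub hadj hd h hj]
    omega
  · rw [dist_comm, hG.dist_eq_sub hadj hd h hi]
    omega

lemma Connected.pathDeg_le_deg [Fintype V] (hG : G.Connected)
    (hadj : ∀ i < d, G.Adj (v i) (v (i + 1))) (hd : G.dist (v 0) (v d) = d)
    {i : ℕ} (hi : i ≤ d) : pathDeg d i ≤ deg G (v i) := by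
  classical
  have hsub : ((range (d + 1)).filter fun j => i + 1 = j ∨ j + 1 = i).image v ⊆
      univ.filter fun w => G.Adj (v i) w := by
    intro w hw
    simp only [mem_image, mem_filter, mem_range] at hw
    obtain ⟨j, ⟨hj, hij⟩, rfl⟩ := hw
    simpa using (hG.adj_geodesic_iff hadj hd hi (by omega)).mpr hij
  have hcard := Finset.card_le_card hsub
  rw [Finset.card_image_of_injOn
    ((hG.injOn_geodesic hadj hd).mono (by simp [Set.subset_def]; tauto))] at hcard
  have hdeg : (if i = 0 then 0 else 1) + (if i = d then 0 else 1) ≤ deg G (v i) := by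
    refine le_trans ?_ (hcard.trans (le_of_eq ?_))
    · have hsub' : (if i = 0 then ∅ else {i - 1}) ∪ (if i = d then ∅ else {i + 1}) ⊆
          (range (d + 1)).filter fun j => i + 1 = j ∨ j + 1 = i := by
        intro j hj
        simp only [mem_filter, mem_range]
        split_ifs at hj <;> simp at hj <;> omega
      refine le_trans (le_of_eq ?_) (Finset.card_le_card hsub')
      rw [Finset.card_union_of_disjoint]
      · split_ifs <;> simp
      · split_ifs <;> simp
    · unfold deg
      congr
  have hdeg' : ((if i = 0 then 0 else 1) + (if i = d then 0 else 1) : ℝ) ≤ deg G (v i) := by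
    exact_mod_cast hdeg
  refine le_trans (le_of_eq ?_) hdeg'
  unfold pathDeg
  split_ifs <;> norm_num

/-- The distance from a vertex of a tree to the vertices of a geodesic has no interior local
maximum, hence it grows all the way to one of the two ends. -/
lemma IsTree.dist_geodesic_end (hG : G.IsTree) (hadj : ∀ i < d, G.Adj (v i) (v (i + 1)))
    (hd : G.dist (v 0) (v d) = d) (w : V) {i : ℕ} (hi : i ≤ d) :
    G.dist w (v 0) = G.dist w (v i) + i ∨ G.dist w (v d) = G.dist w (v i) + (d - i) := by
  have nomax (j : ℕ) (hj : j + 1 < d) (h : G.dist w (v (j + 1)) = G.dist w (v j) + 1) :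
      G.dist w (v (j + 1 + 1)) = G.dist w (v (j + 1)) + 1 := by
    rcases hG.dist_eq_dist_add_one_of_adj w (hadj (j + 1) hj) with h' | h'
    · have := hG.eq_of_dist_add_one_eq (hadj j (by omega)) (hadj (j + 1) hj).symm h h'
      have := hG.connected.injOn_geodesic hadj hd (by simp; omega) (by simp; omega) this
      omega
    · exact h'
  have down (j : ℕ) (hj : j < d) (h : G.dist w (v j) = G.dist w (v (j + 1)) + 1) :
      G.dist w (v 0) = G.dist w (v j) + j := by
    induction j with
    | zero => rfl
    | succ j ih =>
      rcases hG.dist_eq_dist_add_one_of_adj w (hadj j (by omega)) with h' | h'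
      · have := ih (by omega) h'
        omega
      · have := nomax j hj h'
        omega
  have up (j k : ℕ) (hj : j + k < d) (h : G.dist w (v (j + 1)) = G.dist w (v j) + 1) :
      G.dist w (v (j + k + 1)) = G.dist w (v (j + k)) + 1 ∧
        G.dist w (v (j + k + 1)) = G.dist w (v j) + (k + 1) := by
    induction k with
    | zero => simpa using h
    | succ k ih =>
      obtain ⟨h1, h2⟩ := ih (by omega)
      have := nomax (j + k) (by omega) h1
      rw [← add_assoc]
      exact ⟨this, by omega⟩
  rcases hi.eq_or_lt with rfl | hi
  · right
    omega
  · rcases hG.dist_eq_dist_add_one_of_adj w (hadj i hi) with h | h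
    · exact Or.inl (down i hi h)
    · right
      have := (up i (d - i - 1) (by omega) h).2
      rw [show i + (d - i - 1) + 1 = d by omega] at this
      omega

lemma IsTree.ecc_geodesic_le [Fintype V] (hG : G.IsTree)
    (hadj : ∀ i < d, G.Adj (v i) (v (i + 1))) (hd : G.dist (v 0) (v d) = d)
    (hdiam : ∀ x y, G.dist x y ≤ d) {i : ℕ} (hi : i ≤ d) :
    ecc G (v i) ≤ max i (d - i) := by
  refine Finset.sup_le fun w _ => ?_
  have h0 := hdiam w (v 0)
  have h1 := hdiam w (v d)
  rw [dist_comm]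
  rcases hG.dist_geodesic_end hadj hd w hi with h | h <;> omega

lemma Connected.nonempty_iso_pathGraph [Fintype V] (hG : G.Connected)
    (hadj : ∀ i < d, G.Adj (v i) (v (i + 1))) (hd : G.dist (v 0) (v d) = d)
    (hcard : Fintype.card V = d + 1) : Nonempty (G ≃g pathGraph (d + 1)) := by
  have hinj : Function.Injective fun i : Fin (d + 1) => v i := fun i j hij =>
    Fin.ext (hG.injOn_geodesic hadj hd (by simp [i.is_le]) (by simp [j.is_le]) hij)
  have hbij := (Fintype.bijective_iff_injective_and_card _).mpr ⟨hinj, by simp [hcard]⟩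
  refine ⟨RelIso.symm ⟨Equiv.ofBijective _ hbij, fun {i j} => ?_⟩⟩
  rw [pathGraph_adj]
  exact hG.adj_geodesic_iff hadj hd (by omega) (by omega)

lemma IsTree.sum_deg [Fintype V] (hG : G.IsTree) :
    ∑ u, (deg G u : ℝ) = 2 * ((Fintype.card V : ℝ) - 1) := by
  classical
  have h1 := G.sum_degrees_eq_twice_card_edges
  have h2 := hG.card_edgeFinset
  have h3 (u : V) : deg G u = G.degree u := by
    rw [← card_neighborFinset_eq_degree, neighborFinset_eq_filter]
    unfold deg
    congr
  have h4 : ∑ u, deg G u = 2 * #G.edgeFinset := by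
    rw [← h1]
    exact Finset.sum_congr rfl fun u _ => h3 u
  rw [← h2]
  push_cast
  rw [add_sub_cancel_right]
  exact_mod_cast h4

lemma IsTree.le_cei [Fintype V] (hG : G.IsTree)
    (hadj : ∀ i < d, G.Adj (v i) (v (i + 1))) (hd : G.dist (v 0) (v d) = d)
    (hdiam : ∀ x y, G.dist x y ≤ d) (hpos : 1 ≤ d) :
    2 * pathRecipSum d - 2 / d + 2 * ((Fintype.card V : ℝ) - 1 - d) / d ≤ cei G := by
  classical
  have hd0 : (0 : ℝ) < d := by exact_mod_cast hpos
  have hinj := hG.connected.injOn_geodesic hadj hd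
  have : Nontrivial V := by
    refine ⟨v 0, v d, fun h => ?_⟩
    rw [h, dist_self] at hd
    omega
  have hecc_pos (u : V) : (0 : ℝ) < ecc G u := by
    obtain ⟨w, hw⟩ := exists_ne u
    exact_mod_cast (hG.connected.pos_dist_of_ne hw.symm).trans_le (le_ecc G u w)
  have hecc_le (u : V) : (ecc G u : ℝ) ≤ d := by
    exact_mod_cast Finset.sup_le fun w _ => hdiam u w
  have hexcess (u : V) : (0 : ℝ) ≤ 1 / ecc G u - 1 / d :=
    sub_nonneg.mpr (one_div_le_one_div_of_le (hecc_pos u) (hecc_le u))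
  have hpath : ∑ i ∈ range (d + 1), pathDeg d i * (1 / ((max i (d - i) : ℕ) : ℝ) - 1 / d) ≤
      ∑ u, (deg G u : ℝ) * (1 / ecc G u - 1 / d) := by
    calc _ ≤ ∑ i ∈ range (d + 1), (deg G (v i) : ℝ) * (1 / ecc G (v i) - 1 / d) := by
          refine Finset.sum_le_sum fun i hi => ?_
          have hi' : i ≤ d := by simpa [Nat.lt_succ_iff] using hi
          have hmax : max i (d - i) ≤ d := by omega
          have hmax' : 0 < max i (d - i) := by omega
          refine mul_le_mul (hG.connected.pathDeg_le_deg hadj hd hi') ?_ ?_ (Nat.cast_nonneg _)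
          · refine sub_le_sub_right (one_div_le_one_div_of_le (hecc_pos _) ?_) _
            exact_mod_cast hG.ecc_geodesic_le hadj hd hdiam hi'
          · refine sub_nonneg.mpr (one_div_le_one_div_of_le ?_ ?_)
            · exact_mod_cast hmax'
            · exact_mod_cast hmax
      _ = ∑ u ∈ (range (d + 1)).image v, (deg G u : ℝ) * (1 / ecc G u - 1 / d) :=
          (Finset.sum_image (f := fun u => (deg G u : ℝ) * (1 / ecc G u - 1 / d)) hinj).symm
      _ ≤ _ := Finset.sum_le_sum_of_subset_of_nonneg (subset_univ _) fun u _ _ =>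
          mul_nonneg (Nat.cast_nonneg _) (hexcess u)
  have hleft : ∑ i ∈ range (d + 1), pathDeg d i * (1 / ((max i (d - i) : ℕ) : ℝ) - 1 / d) =
      2 * pathRecipSum d - 2 / d - 2 := by
    simp_rw [mul_sub, Finset.sum_sub_distrib]
    rw [sum_pathDeg_div_max, sum_pathDeg_mul d (fun _ => 1 / (d : ℝ))]
    simp only [sum_const, card_range, nsmul_eq_mul]
    push_cast
    field_simp
    ring
  have hright : ∑ u, (deg G u : ℝ) * (1 / ecc G u - 1 / d) =
      cei G - 2 * ((Fintype.card V : ℝ) - 1) / d := by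
    simp_rw [mul_sub, Finset.sum_sub_distrib, mul_one_div]
    rw [← Finset.sum_div, hG.sum_deg, cei]
    ring
  have e : 2 * ((Fintype.card V : ℝ) - 1 - d) / d = 2 * ((Fintype.card V : ℝ) - 1) / d - 2 := by
    field_simp
  rw [hleft, hright] at hpath
  linarith

end Geodesic

end SimpleGraph

/-- among all trees on `n ≥ 6` vertices the path `P_n` uniquely
minimizes the connective eccentricity index. -/
theorem cei_path_unique_min {n : ℕ} (hn : 6 ≤ n)
    [Fintype V] (hcard : Fintype.card V = n)
    (T : SimpleGraph V) (hT : T.IsTree)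
    (hP : IsEmpty (T ≃g SimpleGraph.pathGraph n)) :
    cei (SimpleGraph.pathGraph n) < cei T := by
  have : Nontrivial V := Fintype.one_lt_card_iff_nontrivial.mp (by omega)
  obtain ⟨⟨x, y⟩, hxy⟩ := Finite.exists_max fun p : V × V => T.dist p.1 p.2
  obtain ⟨v, hv0, hvd, hadj⟩ := hT.connected.exists_geodesic x y
  replace hxy (a b : V) : T.dist a b ≤ T.dist x y := hxy (a, b)
  generalize hd : T.dist x y = d at hvd hadj hxy
  rw [← hv0, ← hvd] at hd
  have hpos : 1 ≤ d := by
    obtain ⟨a, b, hab⟩ := exists_pair_ne V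
    exact (hT.connected.pos_dist_of_ne hab).trans_le (hxy a b)
  obtain ⟨m, rfl⟩ : ∃ m, n = m + 1 := ⟨n - 1, by omega⟩
  have hdm : d < m := by
    have hle := Finset.card_le_card_of_injOn v (fun _ _ => mem_univ _)
      (hT.connected.injOn_geodesic hadj hd)
    rw [card_range, card_univ, hcard] at hle
    have hne : d ≠ m := by
      rintro rfl
      exact not_isEmpty_iff.mpr (hT.connected.nonempty_iso_pathGraph hadj hd hcard) hP
    omega
  have h1 := cei_pathGraph_le (d := m) (by omega)
  have h2 := pathRecipSum_lt hpos hdm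
  have h3 := hT.le_cei hadj hd hxy hpos
  rw [hcard] at h3
  push_cast at h3
  rw [add_sub_cancel_right] at h3
  linarith
end

section
/- For every tree T with n ≥ 6 vertices that is not isomorphic to the star S_n, one has ξ^{ce}(T) < ξ^{ce}(S_n); that is, among all trees on n vertices the star uniquely maximizes the connective eccentricity index. -/
open Finset SimpleGraph

variable {V : Type*}

/-- The star `S_n` on `Fin n`, with center `0`. -/
def starG (n : ℕ) : SimpleGraph (Fin n) :=
  SimpleGraph.fromRel (fun x _ => (x : ℕ) = 0)

section Eccentricity

variable {W : Type*} [Fintype W] {G : SimpleGraph W}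

lemma deg_eq_degree (G : SimpleGraph W) [DecidableRel G.Adj] (u : W) : deg G u = G.degree u := by
  rw [← card_neighborFinset_eq_degree, deg]
  congr 1
  ext v
  simp

lemma dist_le_ecc_s4 (G : SimpleGraph W) (u v : W) : G.dist u v ≤ ecc G u :=
  Finset.le_sup (f := fun v => G.dist u v) (mem_univ v)

/-- A non-adjacent pair of distinct vertices of a connected graph forces eccentricity at least 2. -/
lemma two_le_ecc_of_not_adj (hG : G.Connected) {u v : W} (hne : u ≠ v) (hadj : ¬ G.Adj u v) :
    2 ≤ ecc G u := by
  have h0 : 0 < G.dist u v := hG.pos_dist_of_ne hne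
  have h1 : G.dist u v ≠ 1 := fun h => hadj (dist_eq_one_iff_adj.mp h)
  have := dist_le_ecc_s4 G u v
  omega

lemma ecc_eq_one_of_forall_adj [Nontrivial W] {c : W} (hc : ∀ v, c ≠ v → G.Adj c v) :
    ecc G c = 1 := by
  refine le_antisymm (Finset.sup_le fun v _ => ?_) ?_
  · rcases eq_or_ne c v with rfl | h
    · simp
    · exact (dist_eq_one_iff_adj.mpr (hc v h)).le
  · obtain ⟨v, hv⟩ := exists_ne c
    rw [← dist_eq_one_iff_adj.mpr (hc v hv.symm)]
    exact dist_le_ecc_s4 G c v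

lemma deg_eq_of_forall_adj {c : W} (hc : ∀ v, c ≠ v → G.Adj c v) :
    deg G c = Fintype.card W - 1 := by
  classical
  rw [deg, ← Finset.card_univ, ← Finset.card_erase_of_mem (mem_univ c)]
  congr 1
  ext v
  simp only [mem_filter, mem_univ, true_and, mem_erase, and_true]
  exact ⟨fun h => h.ne', fun h => hc v h.symm⟩

lemma SimpleGraph.IsTree.sum_deg_s4 (hG : G.IsTree) :
    ∑ u, (deg G u : ℝ) = 2 * ((Fintype.card W : ℝ) - 1) := by
  classical
  have h1 := G.sum_degrees_eq_twice_card_edges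
  have h2 := hG.card_edgeFinset
  simp only [deg_eq_degree, ← Nat.cast_sum, h1, ← h2]
  push_cast
  ring

/-- A tree without a dominating vertex on `n` vertices has index at most `n - 1`. -/
lemma SimpleGraph.IsTree.cei_le (hG : G.IsTree) (h : ∀ c, ∃ v, c ≠ v ∧ ¬ G.Adj c v) :
    cei G ≤ (Fintype.card W : ℝ) - 1 := by
  calc cei G ≤ ∑ u, (deg G u : ℝ) / 2 := by
        refine Finset.sum_le_sum fun u _ => ?_
        obtain ⟨v, hne, hadj⟩ := h u
        have : (2 : ℝ) ≤ ecc G u := by exact_mod_cast two_le_ecc_of_not_adj hG.1 hne hadj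
        gcongr
    _ = (Fintype.card W : ℝ) - 1 := by rw [← Finset.sum_div, hG.sum_deg_s4]; ring

end Eccentricity

lemma starG_adj {n : ℕ} {x y : Fin n} :
    (starG n).Adj x y ↔ x ≠ y ∧ ((x : ℕ) = 0 ∨ (y : ℕ) = 0) := by
  simp [starG]

lemma lt_cei_starG {n : ℕ} (hn : 2 ≤ n) : (n : ℝ) - 1 < cei (starG n) := by
  obtain ⟨m, rfl⟩ : ∃ m, n = m + 2 := ⟨n - 2, by omega⟩
  have hc : ∀ v : Fin (m + 2), 0 ≠ v → (starG (m + 2)).Adj 0 v := fun v hv =>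
    starG_adj.mpr ⟨hv, Or.inl rfl⟩
  have h01 : (starG (m + 2)).Adj 1 0 := (hc 1 (by simp)).symm
  have hdeg : 0 < deg (starG (m + 2)) 1 :=
    Finset.card_pos.mpr ⟨0, by simpa using h01⟩
  have hecc : 0 < ecc (starG (m + 2)) 1 :=
    (dist_eq_one_iff_adj.mpr h01 ▸ Nat.one_pos).trans_le (dist_le_ecc_s4 _ 1 0)
  have hpos : (0 : ℝ) < deg (starG (m + 2)) 1 / ecc (starG (m + 2)) 1 := by positivity
  have hle : ∑ u ∈ {0, 1}, (deg (starG (m + 2)) u : ℝ) / ecc (starG (m + 2)) u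
      ≤ cei (starG (m + 2)) :=
    Finset.sum_le_sum_of_subset_of_nonneg (Finset.subset_univ _) fun _ _ _ => by positivity
  rw [Finset.sum_pair (by simp), deg_eq_of_forall_adj hc, ecc_eq_one_of_forall_adj hc,
    Fintype.card_fin] at hle
  push_cast at hle ⊢
  linarith

/-- In an acyclic graph two neighbors of a vertex are never adjacent. -/
lemma SimpleGraph.IsAcyclic.not_adj_of_adj {W : Type*} {G : SimpleGraph W} (hG : G.IsAcyclic)
    {c u v : W} (hu : G.Adj c u) (hv : G.Adj c v) : ¬ G.Adj u v := by
  intro huv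
  have hp : (Walk.cons huv Walk.nil).IsPath := by simp [huv.ne]
  have hq : (Walk.cons hu.symm (Walk.cons hv Walk.nil)).IsPath := by
    simp [huv.ne, hu.ne', hv.ne]
  have := congrArg (fun p : G.Path u v => p.1.length)
    ((hG.subsingleton_path u v).elim ⟨_, hp⟩ ⟨_, hq⟩)
  simp at this

/-- A tree with a dominating vertex is a star. -/
lemma SimpleGraph.IsAcyclic.nonempty_iso_starG {W : Type*} [Fintype W] {G : SimpleGraph W}
    (hG : G.IsAcyclic) {n : ℕ} (hcard : Fintype.card W = n) {c : W}
    (hc : ∀ v, c ≠ v → G.Adj c v) : Nonempty (G ≃g starG n) := by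
  classical
  have : NeZero n := ⟨hcard ▸ (Fintype.card_pos_iff.mpr ⟨c⟩).ne'⟩
  let e₀ := Fintype.equivFinOfCardEq hcard
  let e := e₀.trans (Equiv.swap (e₀ c) 0)
  have he : ∀ v, ((e v : Fin n) : ℕ) = 0 ↔ v = c := by
    have hec : e c = 0 := by simp [e]
    intro v
    rw [← Fin.val_zero n, ← Fin.ext_iff, ← hec, e.apply_eq_iff_eq]
  refine ⟨⟨e, fun {u v} => ?_⟩⟩
  rw [starG_adj, he, he, e.injective.ne_iff]
  constructor
  · rintro ⟨hne, rfl | rfl⟩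
    · exact hc v hne
    · exact (hc u hne.symm).symm
  · intro h
    refine ⟨h.ne, ?_⟩
    by_contra! hcon
    exact hG.not_adj_of_adj (hc u hcon.1.symm) (hc v hcon.2.symm) h

/-- among all trees on `n ≥ 6` vertices the star `S_n` uniquely
maximizes the connective eccentricity index. -/
theorem cei_star_unique_max {n : ℕ} (hn : 6 ≤ n)
    [Fintype V] (hcard : Fintype.card V = n)
    (T : SimpleGraph V) (hT : T.IsTree)
    (hS : IsEmpty (T ≃g starG n)) :
    cei T < cei (starG n) := by
  have hle : cei T ≤ (Fintype.card V : ℝ) - 1 := by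
    refine hT.cei_le ?_
    by_contra! ⟨c, hc⟩
    exact hS.elim (hT.2.nonempty_iso_starG hcard hc).some
  rw [hcard] at hle
  exact hle.trans_lt (lt_cei_starG (by omega))
end

section
/- Let d̄ = (d₁,…,d_n) be a tree degree sequence and let T be a tree with degree sequence d̄ such that ξ^{ce}(T) is minimum among all trees with degree sequence d̄. Then T is a caterpillar, i.e., every vertex of T not on some fixed longest path of T is a leaf (equivalently, deleting all leaves of T leaves a path). -/
open Finset SimpleGraph

variable {V : Type*}

/-- `G` has degree sequence `d = (d₁, …, d_n)` (up to relabeling of the vertices). -/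
def hasDegSeq [Fintype V] (G : SimpleGraph V) {n : ℕ} (d : Fin n → ℕ) : Prop :=
  ∃ e : V ≃ Fin n, ∀ v, deg G v = d (e v)

/-- A caterpillar: removing all vertices of degree one yields a path. -/
def IsCaterpillar [Fintype V] (T : SimpleGraph V) : Prop :=
  ∃ m : ℕ,
    Nonempty ((SimpleGraph.induce {v | deg T v ≠ 1} T) ≃g SimpleGraph.pathGraph m)


namespace SimpleGraph

/-- In a tree, an edge `ab` separating `x` from `y` lies on the path from `x` to `y`. -/
theorem IsTree.dist_eq_of_separating {T : SimpleGraph V} (hT : T.IsTree) {a b x y : V}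
    (hab : T.Adj a b) (hx : T.dist x a < T.dist x b) (hy : T.dist y b < T.dist y a) :
    T.dist x y = T.dist x a + 1 + T.dist b y := by
  have hc := hT.connected
  obtain ⟨p, hp, hpl⟩ := hc.exists_path_of_dist x a
  obtain ⟨q, hq, hql⟩ := hc.exists_path_of_dist b y
  have on_geodesic : ∀ {s t z : V} (r : T.Walk s t), r.length = T.dist s t → z ∈ r.support →
      T.dist s z + T.dist z t ≤ T.dist s t := by
    classical
    intro s t z r hr hz
    have hlen := congrArg Walk.length (r.take_spec hz)
    rw [Walk.length_append] at hlen
    have h₁ := T.dist_le (r.takeUntil z hz)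
    have h₂ := T.dist_le (r.dropUntil z hz)
    omega
  have hpath : (p.append (Walk.cons hab q)).IsPath := by
    rw [Walk.isPath_def, Walk.support_append, Walk.support_cons, List.tail_cons,
      List.nodup_append']
    refine ⟨hp.support_nodup, hq.support_nodup, fun z hzp hzq => ?_⟩
    have h₁ := on_geodesic p hpl hzp
    have h₂ := on_geodesic q hql hzq
    have h₃ := hc.dist_triangle (u := x) (v := z) (w := b)
    have h₄ := hc.dist_triangle (u := y) (v := z) (w := a)
    rw [T.dist_comm (u := b) (v := z), T.dist_comm (u := b) (v := y),
      T.dist_comm (u := z) (v := y)] at h₂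
    omega
  obtain ⟨r, hr, hrl⟩ := hc.exists_path_of_dist x y
  have huniq : r = p.append (Walk.cons hab q) := (hT.existsUnique_path x y).unique hr hpath
  rw [← hrl, huniq, Walk.length_append, Walk.length_cons, hpl, hql]
  omega

theorem IsTree.eq_of_adj_of_separating {T : SimpleGraph V} (hT : T.IsTree) {a b x y : V}
    (hab : T.Adj a b) (hxy : T.Adj x y) (hx : T.dist x a < T.dist x b)
    (hy : T.dist y b < T.dist y a) : x = a ∧ y = b := by
  have h := hT.dist_eq_of_separating hab hx hy
  rw [dist_eq_one_iff_adj.2 hxy] at h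
  have hc := hT.connected
  exact ⟨hc.dist_eq_zero_iff.1 (by omega), (hc.dist_eq_zero_iff.1 (by omega)).symm⟩

/-- Along a walk, a function that grows by at most one per edge grows by at most the distance. -/
theorem Connected.le_add_dist_s6 {G : SimpleGraph V} (hG : G.Connected) {f : V → ℕ}
    (hf : ∀ a b, G.Adj a b → f a ≤ f b + 1) (a b : V) : f a ≤ f b + G.dist a b := by
  have key : ∀ {a b : V} (p : G.Walk a b), f a ≤ f b + p.length := by
    intro a b p
    induction p with
    | nil => simp
    | cons h p ih =>
      have := hf _ _ h
      rw [Walk.length_cons]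
      omega
  obtain ⟨p, hp⟩ := hG.exists_walk_length_eq_dist a b
  exact hp ▸ key p

theorem Connected.dist_le_dist_add_one {G : SimpleGraph V} (hG : G.Connected) (x : V) {a b : V}
    (h : G.Adj a b) : G.dist x a ≤ G.dist x b + 1 := by
  have := hG.dist_triangle (u := x) (v := b) (w := a)
  rwa [dist_eq_one_iff_adj.2 h.symm] at this

theorem Iso.dist_eq {W : Type*} {G : SimpleGraph V} {H : SimpleGraph W} (f : G ≃g H)
    (hG : G.Connected) (hH : H.Connected) (x y : V) : H.dist (f x) (f y) = G.dist x y := by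
  apply le_antisymm
  · obtain ⟨p, hp⟩ := hG.exists_walk_length_eq_dist x y
    rw [← hp, ← Walk.length_map f.toHom p]
    exact H.dist_le _
  · obtain ⟨p, hp⟩ := hH.exists_walk_length_eq_dist (f x) (f y)
    rw [← hp, ← Walk.length_map f.symm.toHom p]
    have h := G.dist_le (p.map f.symm.toHom)
    simpa using h

/-- Points of a unit-step sequence realizing the distance of its ends are at index distance. -/
theorem Connected.dist_of_geodesic {G : SimpleGraph V} (hG : G.Connected) {u : ℕ → V} {D : ℕ}
    (hu : ∀ l < D, G.Adj (u l) (u (l + 1))) (hD : G.dist (u 0) (u D) = D) {i j : ℕ}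
    (hij : i ≤ j) (hj : j ≤ D) : G.dist (u i) (u j) = j - i := by
  have upper : ∀ i k, i + k ≤ D → G.dist (u i) (u (i + k)) ≤ k := by
    intro i k
    induction k with
    | zero => simp
    | succ k ih =>
      intro h
      have := ih (by omega)
      have := hG.dist_le_dist_add_one (u i) (hu (i + k) (by omega)).symm
      rw [← add_assoc]
      omega
  obtain ⟨k, rfl⟩ := Nat.exists_eq_add_of_le hij
  have h₁ := upper 0 i (by omega)
  have h₂ := upper i k hj
  have h₃ := upper (i + k) (D - (i + k)) (by omega)
  rw [zero_add] at h₁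
  rw [Nat.add_sub_cancel' hj] at h₃
  have h₄ := hG.dist_triangle (u := u 0) (v := u i) (w := u D)
  have h₅ := hG.dist_triangle (u := u i) (v := u (i + k)) (w := u D)
  omega

/-- The graph obtained by attaching to `v` the branches at `w` that make up the set `S`. -/
def moveBranch (G : SimpleGraph V) (S : Set V) (w v : V) (hv : v ∉ S) : SimpleGraph V where
  Adj x y := ((x ∈ S ↔ y ∈ S) ∧ G.Adj x y) ∨ (x ∈ S ∧ y = v ∧ G.Adj x w) ∨
    (y ∈ S ∧ x = v ∧ G.Adj y w)
  symm := ⟨by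
    rintro x y (⟨h, hxy⟩ | h | h)
    · exact Or.inl ⟨h.symm, hxy.symm⟩
    · exact Or.inr (Or.inr h)
    · exact Or.inr (Or.inl h)⟩
  loopless := ⟨by
    rintro x (⟨-, h⟩ | ⟨h, rfl, -⟩ | ⟨h, rfl, -⟩)
    · exact G.loopless.irrefl _ h
    · exact hv h
    · exact hv h⟩

theorem moveBranch_connected {G : SimpleGraph V} (hG : G.Connected) {S : Set V} {w v : V}
    (hw : w ∉ S) (hv : v ∉ S) (hS : ∀ x ∈ S, ∀ y ∉ S, G.Adj x y → y = w)
    (hwv : (G.moveBranch S w v hv).Reachable w v) : (G.moveBranch S w v hv).Connected := by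
  have cross : ∀ x ∈ S, ∀ y ∉ S, G.Adj x y → (G.moveBranch S w v hv).Reachable x y := by
    intro x hx y hy hxy
    obtain rfl := hS x hx y hy hxy
    exact (Adj.reachable (Or.inr (Or.inl ⟨hx, rfl, hxy⟩))).trans hwv.symm
  have step : ∀ x y, G.Adj x y → (G.moveBranch S w v hv).Reachable x y := by
    intro x y hxy
    by_cases hx : x ∈ S <;> by_cases hy : y ∈ S
    · exact Adj.reachable (Or.inl ⟨by simp [hx, hy], hxy⟩)
    · exact cross x hx y hy hxy
    · exact (cross y hy x hx hxy.symm).symm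
    · exact Adj.reachable (Or.inl ⟨by simp [hx, hy], hxy⟩)
  have := hG.nonempty
  refine ⟨fun x y => ?_⟩
  obtain ⟨p⟩ := hG.preconnected x y
  induction p with
  | nil => rfl
  | cons h p ih => exact (step _ _ h).trans ih

end SimpleGraph

theorem deg_eq_ncard_s6 [Fintype V] (G : SimpleGraph V) (x : V) :
    deg G x = (G.neighborSet x).ncard := by
  classical
  rw [deg, Set.ncard_eq_toFinset_card']
  congr 1
  ext y
  simp

theorem SimpleGraph.Iso.deg_eq {W : Type*} [Fintype V] [Fintype W] {G : SimpleGraph V}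
    {H : SimpleGraph W} (f : G ≃g H) (x : V) : deg H (f x) = deg G x := by
  rw [deg_eq_ncard_s6, deg_eq_ncard_s6, ← Nat.card_coe_set_eq, ← Nat.card_coe_set_eq]
  exact (Nat.card_congr (f.mapNeighborSet x)).symm

theorem SimpleGraph.Iso.cei_eq {W : Type*} [Fintype V] [Fintype W] {G : SimpleGraph V}
    {H : SimpleGraph W} (f : G ≃g H) (hG : G.Connected) (hH : H.Connected) : cei H = cei G := by
  have hecc : ∀ x, ecc H (f x) = ecc G x := by
    intro x
    apply le_antisymm
    · refine Finset.sup_le fun y _ => ?_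
      obtain ⟨z, rfl⟩ := f.surjective y
      exact (f.dist_eq hG hH x z).trans_le (dist_le_ecc G x z)
    · exact Finset.sup_le fun y _ => (f.dist_eq hG hH x y).symm.trans_le (dist_le_ecc H _ _)
  refine (Fintype.sum_equiv f.toEquiv _ _ fun x => ?_).symm
  change (deg G x : ℝ) / ecc G x = deg H (f x) / ecc H (f x)
  rw [f.deg_eq, hecc]

theorem SimpleGraph.IsTree.of_sum_deg_eq [Fintype V] {G T : SimpleGraph V}
    (hT : T.IsTree) (hG : G.Connected) (h : ∑ x, deg G x = ∑ x, deg T x) : G.IsTree := by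
  classical
  have twice : ∀ H : SimpleGraph V, ∑ x, deg H x = 2 * Nat.card H.edgeSet := by
    intro H
    rw [Nat.card_eq_fintype_card, ← edgeFinset_card, ← H.sum_degrees_eq_twice_card_edges]
    refine Finset.sum_congr rfl fun x _ => ?_
    rw [deg_eq_ncard_s6, Set.ncard_eq_toFinset_card', ← card_neighborFinset_eq_degree]
    rfl
  refine isTree_iff_connected_and_card.2 ⟨hG, ?_⟩
  have := (isTree_iff_connected_and_card.1 hT).2
  rw [twice, twice] at h
  omega

theorem SimpleGraph.Connected.exists_adj_dist_add_one_eq {G : SimpleGraph V} (hG : G.Connected)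
    {a v : V} (hne : a ≠ v) : ∃ q, G.Adj v q ∧ G.dist a q + 1 = G.dist a v := by
  obtain ⟨p, hp⟩ := hG.exists_walk_length_eq_dist v a
  cases p with
  | nil => exact absurd rfl hne
  | cons h p =>
    rename_i q
    refine ⟨q, h, ?_⟩
    have h₁ := G.dist_le p
    have h₂ := hG.dist_le_dist_add_one a h
    rw [Walk.length_cons, G.dist_comm] at hp
    rw [G.dist_comm] at h₁
    omega

theorem SimpleGraph.IsTree.deg_eq_one_of_forall_dist_le [Fintype V] {T : SimpleGraph V}
    (hT : T.IsTree) {a v : V} (hne : a ≠ v) (hmax : ∀ y, T.dist a y ≤ T.dist a v) :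
    deg T v = 1 := by
  have hc := hT.connected
  obtain ⟨q, hvq, hq⟩ := hc.exists_adj_dist_add_one_eq hne
  rw [deg_eq_ncard_s6, Set.ncard_eq_one]
  refine ⟨q, Set.eq_singleton_iff_unique_mem.2 ⟨hvq, fun y hy => ?_⟩⟩
  by_contra hyq
  have h₁ : T.dist y v = 1 := dist_eq_one_iff_adj.2 (Adj.symm hy)
  have h₂ : T.dist y q ≠ 0 := fun h => hyq (hc.dist_eq_zero_iff.1 h)
  have h₃ := hT.dist_ne_of_adj y hvq
  have h₄ := hT.dist_eq_of_separating hvq (x := y) (y := a) (by omega) (by omega)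
  have h₅ := hmax y
  rw [T.dist_comm (u := y) (v := a), T.dist_comm (u := q)] at h₄
  omega

theorem deg_moveBranch [Fintype V] [DecidableEq V] {G : SimpleGraph V} {S : Set V} {w v p : V}
    (hw : w ∉ S) (hv : v ∉ S) (hwv : w ≠ v) (hS : ∀ x ∈ S, ∀ y ∉ S, G.Adj x y → y = w)
    (hvdeg : deg G v = 1) (hp : p ∉ S) (hwp : G.Adj w p)
    (huniq : ∀ y ∉ S, G.Adj w y → y = p) (x : V) :
    deg (G.moveBranch S w v hv) x = deg G (Equiv.swap w v x) := by
  rw [deg_eq_ncard_s6, deg_eq_ncard_s6]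
  rw [deg_eq_ncard_s6] at hvdeg
  by_cases hxw : x = w
  · subst hxw
    rw [Equiv.swap_apply_left, hvdeg, Set.ncard_eq_one]
    refine ⟨p, Set.eq_singleton_iff_unique_mem.2 ⟨Or.inl ⟨by simp [hw, hp], hwp⟩, ?_⟩⟩
    rintro y (⟨h, hy⟩ | ⟨h, -⟩ | ⟨-, h, -⟩)
    · exact huniq y (fun hyS => hw (h.2 hyS)) hy
    · exact absurd h hw
    · exact absurd h hwv
  by_cases hxv : x = v
  · subst hxv
    rw [Equiv.swap_apply_right]
    have h₁ : (G.moveBranch S w x hv).neighborSet x = G.neighborSet x ∪ {y ∈ S | G.Adj y w} := by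
      ext y
      constructor
      · rintro (⟨-, h⟩ | ⟨h, -⟩ | ⟨h, -, h'⟩)
        · exact Or.inl h
        · exact absurd h hv
        · exact Or.inr ⟨h, h'⟩
      · rintro (h | ⟨h, h'⟩)
        · refine Or.inl ⟨iff_of_false hv fun hy => ?_, h⟩
          exact hwv (hS y hy x hv (Adj.symm h)).symm
        · exact Or.inr (Or.inr ⟨h, rfl, h'⟩)
    have h₂ : G.neighborSet w = {p} ∪ {y ∈ S | G.Adj y w} := by
      ext y
      constructor
      · intro h
        by_cases hy : y ∈ S
        · exact Or.inr ⟨hy, Adj.symm h⟩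
        · exact Or.inl (huniq y hy h)
      · rintro (rfl | ⟨-, h⟩)
        · exact hwp
        · exact h.symm
    rw [h₁, h₂, Set.ncard_union_eq, Set.ncard_union_eq, hvdeg, Set.ncard_singleton]
    · rw [Set.disjoint_singleton_left]
      exact fun h => hp h.1
    · rw [Set.disjoint_left]
      exact fun y h h' => hwv (hS y h'.1 x hv (Adj.symm h)).symm
  rw [Equiv.swap_apply_of_ne_of_ne hxw hxv]
  by_cases hx : x ∈ S
  · rw [← Set.ncard_image_of_injective (G.neighborSet x) (Equiv.swap w v).injective]
    congr 1
    ext y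
    rw [Equiv.image_eq_preimage_symm, Equiv.symm_swap]
    change _ ↔ G.Adj x (Equiv.swap w v y)
    constructor
    · rintro (⟨h, hy⟩ | ⟨-, rfl, h⟩ | ⟨-, h, -⟩)
      · have hyS := h.1 hx
        rwa [Equiv.swap_apply_of_ne_of_ne (ne_of_mem_of_not_mem hyS hw)
          (ne_of_mem_of_not_mem hyS hv)]
      · rwa [Equiv.swap_apply_right]
      · exact absurd h hxv
    · intro h
      by_cases hyw : y = w
      · rw [hyw, Equiv.swap_apply_left] at h
        exact absurd (hS x hx v hv h).symm hwv
      by_cases hyv : y = v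
      · rw [hyv, Equiv.swap_apply_right] at h
        exact Or.inr (Or.inl ⟨hx, hyv, h⟩)
      rw [Equiv.swap_apply_of_ne_of_ne hyw hyv] at h
      refine Or.inl ⟨iff_of_true hx ?_, h⟩
      by_contra hy
      exact hyw (hS x hx y hy h)
  · congr 1
    ext y
    constructor
    · rintro (⟨-, h⟩ | ⟨h, -⟩ | ⟨-, h, -⟩)
      · exact h
      · exact absurd h hx
      · exact absurd h hxv
    · intro h
      exact Or.inl ⟨iff_of_false hx fun hy => hxw (hS y hy x hx (Adj.symm h)), h⟩

/-- Exchanging two weights so that the larger one meets the smaller factor decreases the sum. -/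
theorem sum_swap_mul_le [Fintype V] [DecidableEq V] {f g : V → ℝ} {w v : V} (hf : f v ≤ f w)
    (hg : g v ≤ g w) : ∑ x, f (Equiv.swap w v x) * g x ≤ ∑ x, f x * g x := by
  by_cases hwv : w = v
  · simp [hwv]
  rw [← sub_nonneg, ← Finset.sum_sub_distrib,
    ← Finset.sum_subset (Finset.subset_univ {w, v}), Finset.sum_pair hwv]
  · rw [Equiv.swap_apply_left, Equiv.swap_apply_right]
    nlinarith
  · intro x _ hx
    simp only [Finset.mem_insert, Finset.mem_singleton, not_or] at hx
    rw [Equiv.swap_apply_of_ne_of_ne hx.1 hx.2, sub_self]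

theorem cei_lt_of_swap [Fintype V] [DecidableEq V] {G H : SimpleGraph V} {w v : V}
    (hdeg : ∀ x, deg H x = deg G (Equiv.swap w v x)) (hpos : ∀ x, 0 < deg G x)
    (hd : deg G v ≤ deg G w) (hpose : ∀ x, 0 < ecc G x) (hwv : ecc G w ≤ ecc G v)
    (hle : ∀ x, ecc G x ≤ ecc H x) {a : V} (hlt : ecc G a < ecc H a) : cei H < cei G := by
  have hG : ∀ x, (0 : ℝ) < ecc G x := fun x => by exact_mod_cast hpose x
  calc cei H < ∑ x, (deg G (Equiv.swap w v x) : ℝ) * (1 / (ecc G x : ℝ)) := by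
        refine Finset.sum_lt_sum (fun x _ => ?_) ⟨a, Finset.mem_univ _, ?_⟩
        · rw [hdeg, mul_one_div]
          have := hG x
          have : (ecc G x : ℝ) ≤ ecc H x := by exact_mod_cast hle x
          gcongr
        · rw [hdeg, mul_one_div]
          have := hG a
          have : (ecc G a : ℝ) < ecc H a := by exact_mod_cast hlt
          have : (0 : ℝ) < deg G (Equiv.swap w v a) := by exact_mod_cast hpos _
          gcongr
    _ ≤ ∑ x, (deg G x : ℝ) * (1 / (ecc G x : ℝ)) := by
        refine sum_swap_mul_le (f := fun x => (deg G x : ℝ)) (g := fun x => 1 / (ecc G x : ℝ)) ?_ ?_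
        · exact_mod_cast hd
        · exact one_div_le_one_div_of_le (hG w) (by exact_mod_cast hwv)
    _ = cei G := Finset.sum_congr rfl fun x _ => mul_one_div _ _

/-- If a non-leaf hangs off a diametral path of a tree, the index can be decreased by moving its
branches to an end of the path. -/
theorem exists_cei_lt_of_off_path [Fintype V] {T : SimpleGraph V} (hT : T.IsTree) {u : ℕ → V}
    {D : ℕ} (hu : ∀ l < D, T.Adj (u l) (u (l + 1))) (hD : T.dist (u 0) (u D) = D)
    (hmax : ∀ x y, T.dist x y ≤ D) (hpos : ∀ x, 0 < deg T x) {w : V} {i : ℕ} (hi : i ≤ D)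
    (hoff : ∀ l ≤ D, u l ≠ w) (hwi : T.Adj w (u i)) (hw : deg T w ≠ 1) :
    ∃ (T' : SimpleGraph V) (σ : Equiv.Perm V), T'.IsTree ∧ (∀ x, deg T' x = deg T (σ x)) ∧
      cei T' < cei T := by
  classical
  have hc := hT.connected
  have hgeo : ∀ {a b}, a ≤ b → b ≤ D → T.dist (u a) (u b) = b - a :=
    fun hab hb => hc.dist_of_geodesic hu hD hab hb
  have hw1 : T.dist w (u i) = 1 := dist_eq_one_iff_adj.2 hwi
  -- the path lies on the side of `u i` with respect to the edge from `w` to `u i`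
  have away : ∀ q l, T.Adj q (u i) → q ≠ w → T.dist (u l) q < T.dist (u l) (u i) →
      T.dist (u l) w = T.dist (u l) (u i) + 1 := by
    intro q l hq hqw hlq
    have h₁ : T.dist w q ≠ 0 := fun h => hqw (hc.dist_eq_zero_iff.1 h).symm
    have h₂ := hT.dist_ne_of_adj w hq
    have h₃ := hT.dist_eq_of_separating hq hlq (y := w) (by omega)
    have h₄ := hc.dist_le_dist_add_one (u l) hq.symm
    rw [T.dist_comm (u := u i) (v := w)] at h₃
    omega
  have hside : ∀ l ≤ D, T.dist (u l) w = T.dist (u l) (u i) + 1 := by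
    intro l hl
    rcases lt_trichotomy l i with h | rfl | h
    · obtain ⟨k, rfl⟩ : ∃ k, i = k + 1 := ⟨i - 1, by omega⟩
      refine away (u k) l (hu k (by omega)) (hoff k (by omega)) ?_
      rw [hgeo (by omega) (by omega), hgeo (by omega) (by omega)]
      omega
    · rw [T.dist_comm, hw1, T.dist_self]
    · refine away (u (i + 1)) l (hu i (by omega)).symm (hoff _ (by omega)) ?_
      rw [T.dist_comm, hgeo (by omega) (by omega), T.dist_comm, hgeo (by omega) (by omega)]
      omega
  have h0i : T.dist (u 0) (u i) = i := hgeo (by omega) hi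
  have hiD : T.dist (u i) (u D) = D - i := hgeo hi le_rfl
  have h0w := hside 0 (by omega)
  have hDw := hside D le_rfl
  rw [T.dist_comm (u := u D) (v := u i)] at hDw
  have hi0 : 1 ≤ i := by
    have := hmax (u D) w
    omega
  have hi1 : i + 1 ≤ D := by
    have := hmax (u 0) w
    omega
  set S : Set V := {x | x ≠ w ∧ T.dist x w < T.dist x (u i)}
  have hwS : w ∉ S := fun h => h.1 rfl
  have huS : ∀ l ≤ D, u l ∉ S := fun l hl h => by
    have := hside l hl
    have := h.2
    omega
  have hvS : u D ∉ S := huS D le_rfl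
  have not_mem : ∀ {x}, x ∉ S → x ≠ w → T.dist x (u i) < T.dist x w := by
    intro x hx hxw
    have h₁ : ¬ T.dist x w < T.dist x (u i) := fun h => hx ⟨hxw, h⟩
    have h₂ := hT.dist_ne_of_adj x hwi
    omega
  have hS : ∀ x ∈ S, ∀ y ∉ S, T.Adj x y → y = w := by
    intro x hx y hy hxy
    by_contra hyw
    exact hx.1 (hT.eq_of_adj_of_separating hwi hxy hx.2 (not_mem hy hyw)).1
  have hnbr : ∀ y, T.Adj w y → y ≠ u i → y ∈ S := by
    intro y hy hyp
    refine ⟨hy.ne', ?_⟩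
    have h₁ : T.dist y w = 1 := dist_eq_one_iff_adj.2 hy.symm
    have h₂ : T.dist y (u i) ≠ 0 := fun h => hyp (hc.dist_eq_zero_iff.1 h)
    have h₃ := hT.dist_ne_of_adj y hwi
    omega
  obtain ⟨c, hwc, hcS⟩ : ∃ c, T.Adj w c ∧ c ∈ S := by
    by_contra! hno
    refine hw ?_
    rw [deg_eq_ncard_s6, Set.ncard_eq_one]
    refine ⟨u i, Set.eq_singleton_iff_unique_mem.2 ⟨hwi, fun y hy => ?_⟩⟩
    by_contra hyp
    exact hno y hy (hnbr y hy hyp)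
  have hvdeg : deg T (u D) = 1 := by
    refine hT.deg_eq_one_of_forall_dist_le (a := u 0) (fun h => ?_) fun y => (hmax _ y).trans hD.ge
    rw [h, T.dist_self] at hD
    omega
  set T' := T.moveBranch S w (u D) hvS
  have hdeg : ∀ x, deg T' x = deg T (Equiv.swap w (u D) x) :=
    deg_moveBranch hwS hvS (hoff D le_rfl).symm hS hvdeg (huS i hi) hwi
      fun y hy hwy => by_contra fun hyp => hy (hnbr y hwy hyp)
  have hc' : T'.Connected := by
    refine moveBranch_connected hc hwS hvS hS ?_
    have hstart : T'.Reachable w (u i) :=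
      Adj.reachable (Or.inl ⟨iff_of_false hwS (huS i hi), hwi⟩)
    have hchain : ∀ k, i + k ≤ D → T'.Reachable (u i) (u (i + k)) := by
      intro k
      induction k with
      | zero => exact fun _ => Reachable.refl _
      | succ k ih =>
        intro hk
        exact (ih (by omega)).trans (Adj.reachable (Or.inl
          ⟨iff_of_false (huS _ (by omega)) (huS _ (by omega)), hu (i + k) (by omega)⟩))
    have := hchain (D - i) (by omega)
    rw [Nat.add_sub_cancel' hi] at this
    exact hstart.trans this
  -- distances inside the complement of `S` do not decrease
  have hkeep : ∀ x ∉ S, ∀ y ∉ S, T.dist x y ≤ ecc T' x := by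
    intro x hx y hy
    have := hc'.le_add_dist_s6 (f := fun z => T.dist x (if z ∈ S then u D else z)) (by
      rintro a b (⟨h, hab⟩ | ⟨ha, rfl, -⟩ | ⟨hb, rfl, -⟩)
      · by_cases ha : a ∈ S
        · simp [ha, h.1 ha]
        · simp only [ha, mt h.2 ha, if_false]
          exact hc.dist_le_dist_add_one x hab
      · simp [ha, hvS]
      · simp [hb, hvS]) y x
    simp only [hx, hy, if_false, T.dist_self, zero_add] at this
    rw [T'.dist_comm] at this
    exact this.trans (dist_le_ecc _ _ _)
  -- the moved vertices get far away from the other end of the path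
  have hfar : ∀ x ∈ S, D + 1 ≤ T'.dist x (u 0) := by
    intro x hx
    have := hc'.le_add_dist_s6 (f := fun z => if z ∈ S then D + 1 else T.dist (u 0) z) (by
      rintro a b (⟨h, hab⟩ | ⟨ha, rfl, -⟩ | ⟨hb, rfl, -⟩)
      · by_cases ha : a ∈ S
        · simp [ha, h.1 ha]
        · simp only [ha, mt h.2 ha, if_false]
          exact hc.dist_le_dist_add_one _ hab
      · simp [ha, hvS, hD]
      · simp only [hb, hvS, if_false, if_true, hD]
        omega) x (u 0)
    simpa [hx, huS 0 (by omega)] using this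
  have hecc : ∀ x, ecc T x ≤ D := fun x => Finset.sup_le fun y _ => hmax x y
  have hvecc : ecc T (u D) = D := by
    refine le_antisymm (hecc _) ?_
    have := dist_le_ecc T (u D) (u 0)
    rwa [T.dist_comm, hD] at this
  have hle : ∀ x, ecc T x ≤ ecc T' x := by
    intro x
    by_cases hx : x ∈ S
    · have h₁ := hecc x
      have h₂ := hfar x hx
      have h₃ := dist_le_ecc T' x (u 0)
      omega
    refine Finset.sup_le fun y _ => ?_
    by_cases hy : y ∉ S
    · exact hkeep x hx y hy
    rw [not_not] at hy
    have hx0 := hkeep x hx (u 0) (huS 0 (by omega))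
    have hxD := hkeep x hx (u D) hvS
    have hy0 := hT.dist_eq_of_separating hwi hy.2 (y := u 0) (by omega)
    have hyD := hT.dist_eq_of_separating hwi hy.2 (y := u D) (by rw [T.dist_comm]; omega)
    have hm0 := hmax y (u 0)
    have hmD := hmax y (u D)
    rw [T.dist_comm (u := u i) (v := u 0)] at hy0
    change T.dist x y ≤ _
    by_cases hxw : x = w
    · rw [hxw, T.dist_comm (v := u D)] at hxD
      rw [hxw, T.dist_comm]
      omega
    have hxy := hT.dist_eq_of_separating hwi hy.2 (not_mem hx hxw)
    rw [T.dist_comm (u := y) (v := x)] at hxy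
    have hstep : T.Adj (u i) (u (i + 1)) := hu i (by omega)
    have h₁ : T.dist (u 0) (u (i + 1)) = i + 1 := hgeo (by omega) (by omega)
    have h₂ : T.dist (u (i + 1)) (u D) = D - (i + 1) := hgeo (by omega) le_rfl
    have h₃ := T.dist_comm (u := u D) (v := u i)
    have h₄ := T.dist_comm (u := u D) (v := u (i + 1))
    have h₅ := T.dist_comm (u := x) (v := u i)
    rcases lt_or_gt_of_ne (hT.dist_ne_of_adj x hstep) with h | h
    · have := hT.dist_eq_of_separating hstep h (y := u D) (by omega)
      omega
    · have := hT.dist_eq_of_separating hstep.symm h (y := u 0) (by omega)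
      have := hc.dist_le_dist_add_one x hstep
      have := T.dist_comm (u := u i) (v := u 0)
      omega
  have hpose : ∀ x, 0 < ecc T x := by
    intro x
    obtain ⟨y, hy⟩ : ∃ y, y ≠ x := by
      by_cases h : x = w
      · exact ⟨u 0, h ▸ hoff 0 (by omega)⟩
      · exact ⟨w, Ne.symm h⟩
    exact (hc.pos_dist_of_ne hy.symm).trans_le (dist_le_ecc T x y)
  refine ⟨T', Equiv.swap w (u D), hT.of_sum_deg_eq hc' ?_, hdeg, ?_⟩
  · simp only [hdeg]
    exact Equiv.sum_comp (Equiv.swap w (u D)) (deg T)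
  · refine cei_lt_of_swap hdeg hpos (hvdeg ▸ hpos w) hpose ((hecc w).trans hvecc.ge) hle (a := c) ?_
    have h₁ := hecc c
    have h₂ := hfar c hcS
    have h₃ := dist_le_ecc T' c (u 0)
    omega

theorem exists_diametral_path [Fintype V] {T : SimpleGraph V} (hT : T.Connected) :
    ∃ (u : ℕ → V) (D : ℕ), (∀ l < D, T.Adj (u l) (u (l + 1))) ∧ T.dist (u 0) (u D) = D ∧
      ∀ x y, T.dist x y ≤ D := by
  have := hT.nonempty
  obtain ⟨⟨a, b⟩, hab⟩ := Finite.exists_max fun z : V × V => T.dist z.1 z.2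
  obtain ⟨p, hp⟩ := hT.exists_walk_length_eq_dist a b
  refine ⟨p.getVert, p.length, fun l hl => p.adj_getVert_succ hl, ?_, fun x y => ?_⟩
  · rw [p.getVert_zero, p.getVert_length, hp]
  · exact hp ▸ hab (x, y)

/-- If a non-leaf lies outside a nonempty set, then some non-leaf outside it is adjacent to it. -/
theorem exists_adj_of_notMem [Fintype V] {T : SimpleGraph V} (hT : T.Connected)
    {P : Set V} {a : V} (ha : a ∈ P) {z : V} (hz : z ∉ P) (hzd : deg T z ≠ 1) :
    ∃ w ∉ P, deg T w ≠ 1 ∧ ∃ p ∈ P, T.Adj w p := by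
  induction hk : T.dist a z using Nat.strong_induction_on generalizing z with
  | _ k ih =>
    obtain ⟨w, hzw, hw⟩ := hT.exists_adj_dist_add_one_eq (ne_of_mem_of_not_mem ha hz)
    by_cases hwP : w ∈ P
    · exact ⟨z, hz, hzd, w, hwP, hzw⟩
    obtain ⟨q, hwq, hq⟩ := hT.exists_adj_dist_add_one_eq (ne_of_mem_of_not_mem ha hwP)
    refine ih (T.dist a w) (by omega) hwP (fun h => ?_) rfl
    rw [deg_eq_ncard_s6, Set.ncard_eq_one] at h
    obtain ⟨r, hr⟩ := h
    have h₁ : z ∈ T.neighborSet w := hzw.symm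
    have h₂ : q ∈ T.neighborSet w := hwq
    rw [hr, Set.mem_singleton_iff] at h₁ h₂
    rw [h₁, ← h₂] at hw hk
    omega

theorem isCaterpillar_of_forall_off_path [Fintype V] {T : SimpleGraph V} (hT : T.IsTree)
    {u : ℕ → V} {D : ℕ} (hu : ∀ l < D, T.Adj (u l) (u (l + 1))) (hD : T.dist (u 0) (u D) = D)
    (hmax : ∀ x y, T.dist x y ≤ D) (hpos : 0 < D)
    (hleaf : ∀ z, (∀ l ≤ D, u l ≠ z) → deg T z = 1) : IsCaterpillar T := by
  have hc := hT.connected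
  have hgeo : ∀ {a b}, a ≤ b → b ≤ D → T.dist (u a) (u b) = b - a :=
    fun hab hb => hc.dist_of_geodesic hu hD hab hb
  have hinj : ∀ {a b}, a ≤ D → b ≤ D → u a = u b → a = b := by
    intro a b ha hb hab
    rcases le_total a b with h | h
    · have := hgeo h hb
      rw [hab, T.dist_self] at this
      omega
    · have := hgeo h ha
      rw [hab, T.dist_self] at this
      omega
  have hne : u 0 ≠ u D := fun h => by have := hinj (by omega) le_rfl h; omega
  have hend : deg T (u D) = 1 :=
    hT.deg_eq_one_of_forall_dist_le hne fun y => (hmax _ y).trans hD.ge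
  have hstart : deg T (u 0) = 1 :=
    hT.deg_eq_one_of_forall_dist_le hne.symm fun y => by
      rw [T.dist_comm (v := u 0), hD]
      exact hmax _ _
  have hinner : ∀ l, l + 1 < D → deg T (u (l + 1)) ≠ 1 := by
    intro l hl h
    rw [deg_eq_ncard_s6, Set.ncard_eq_one] at h
    obtain ⟨r, hr⟩ := h
    have h₁ : u l ∈ T.neighborSet (u (l + 1)) := (hu l (by omega)).symm
    have h₂ : u (l + 1 + 1) ∈ T.neighborSet (u (l + 1)) := hu (l + 1) hl
    rw [hr, Set.mem_singleton_iff] at h₁ h₂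
    have := hinj (by omega) (by omega) (h₁.trans h₂.symm)
    omega
  have hadj : ∀ {a b}, a ≤ D → b ≤ D → (T.Adj (u a) (u b) ↔ a + 1 = b ∨ b + 1 = a) := by
    intro a b ha hb
    rw [← dist_eq_one_iff_adj]
    rcases le_total a b with h | h
    · rw [hgeo h hb]
      omega
    · rw [T.dist_comm, hgeo h ha]
      omega
  let f : Fin (D - 1) → {v | deg T v ≠ 1} := fun k => ⟨u (k + 1), hinner k (by omega)⟩
  have hf : Function.Bijective f := by
    refine ⟨fun a b hab => ?_, ?_⟩
    · have := hinj (by omega) (by omega) (congrArg Subtype.val hab)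
      exact Fin.ext (by omega)
    · rintro ⟨z, hz⟩
      obtain ⟨l, hl, rfl⟩ : ∃ l ≤ D, u l = z := by
        by_contra! h
        exact hz (hleaf z h)
      have h0 : l ≠ 0 := fun h => hz (h ▸ hstart)
      have hlD : l ≠ D := fun h => hz (h ▸ hend)
      refine ⟨⟨l - 1, by omega⟩, Subtype.ext ?_⟩
      change u (l - 1 + 1) = u l
      rw [Nat.sub_add_cancel (by omega)]
  refine ⟨D - 1, ⟨RelIso.symm ⟨Equiv.ofBijective f hf, fun {a b} => ?_⟩⟩⟩
  change T.Adj (u (a + 1)) (u (b + 1)) ↔ _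
  rw [hadj (by omega) (by omega), pathGraph_adj]
  omega

/-- a tree minimizing the connective eccentricity index among all
trees with a given tree degree sequence is a caterpillar. -/
theorem isCaterpillar_of_cei_min {n : ℕ} (d : Fin n → ℕ)
    (hpos : ∀ i, 1 ≤ d i) (hsum : ∑ i, d i = 2 * (n - 1))
    [Fintype V] (T : SimpleGraph V) (hT : T.IsTree) (hd : hasDegSeq T d)
    (hmin : ∀ T' : SimpleGraph (Fin n), T'.IsTree → hasDegSeq T' d →
      cei T ≤ cei T') :
    IsCaterpillar T := by
  obtain ⟨e, he⟩ := hd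
  have hc := hT.connected
  have hdpos : ∀ x, 0 < deg T x := fun x => he x ▸ hpos _
  obtain ⟨u, D, hu, hD, hmax⟩ := exists_diametral_path hc
  have hDpos : 0 < D := by
    have h := hdpos (u 0)
    rw [deg_eq_ncard_s6, Set.ncard_pos] at h
    obtain ⟨y, hy⟩ := h
    exact (hc.pos_dist_of_ne (Adj.ne hy)).trans_le (hmax _ _)
  refine isCaterpillar_of_forall_off_path hT hu hD hmax hDpos fun z hz => ?_
  by_contra hzd
  obtain ⟨w, hwP, hwd, p, ⟨i, hi, rfl⟩, hwp⟩ := exists_adj_of_notMem hc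
    (P := {x | ∃ l ≤ D, u l = x}) ⟨0, by omega, rfl⟩ (fun ⟨l, hl, h⟩ => hz l hl h) hzd
  obtain ⟨T', σ, hT', hdeg, hlt⟩ := exists_cei_lt_of_off_path hT hu hD hmax hdpos hi
    (fun l hl h => hwP ⟨l, hl, h⟩) hwp hwd
  let f : T' ≃g T'.map e.toEmbedding := Iso.map e T'
  have hfT : (T'.map e.toEmbedding).IsTree := f.isTree_iff.1 hT'
  refine (hmin _ hfT ⟨e.symm.trans (σ.trans e), fun v => ?_⟩).not_gt
    (f.cei_eq hT'.connected hfT.connected ▸ hlt)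
  obtain ⟨x, rfl⟩ := e.surjective v
  have h := f.deg_eq x
  change deg _ (e x) = _ at h
  rw [h, hdeg, he]
  simp
end

section
/- Among all rooted trees with a given level-degree sequence, the level-greedy rooted tree maximizes the connective eccentricity index; that is, if T is any rooted tree with level-degree sequence L₀, L₁, …, and T* is the level-greedy rooted tree for the same level-degree sequence, then ξ^{ce}(T) ≤ ξ^{ce}(T*). -/
open Finset SimpleGraph

variable {V : Type*}

/-- The rooted tree `(T, r)` has level-degree sequence `L`: for each `i`, `L i` is the
multiset of degrees of the vertices at height (distance from the root) `i`. -/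
def hasLevelDegSeq [Fintype V] (T : SimpleGraph V) (r : V) (L : ℕ → Multiset ℕ) : Prop :=
  ∀ i : ℕ, L i = ((Finset.univ.filter (fun v => T.dist r v = i)).val.map (deg T))

/-- The rooted tree `(T, r)` is level-greedy: there is a left-to-right ordering `ord`
of the vertices of each level such that within every level the degrees are
non-increasing from left to right, and each vertex of a level joins its children to
the first so-far-unconnected vertices of the next level, i.e. the children of an
earlier vertex come before the children of a later vertex. -/
def IsLevelGreedy [Fintype V] (T : SimpleGraph V) (r : V) : Prop :=
  ∃ ord : V → ℕ,
    (∀ u v, T.dist r u = T.dist r v → ord u = ord v → u = v) ∧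
    (∀ u v, T.dist r u = T.dist r v → ord u ≤ ord v → deg T v ≤ deg T u) ∧
    (∀ p q u v, T.dist r u = T.dist r v →
      T.Adj p u → T.dist r u = T.dist r p + 1 →
      T.Adj q v → T.dist r v = T.dist r q + 1 →
      ord p < ord q → ord u < ord v)

/-- The rooted tree `(T, r)` is the greedy tree for its degree sequence: it is
level-greedy, the root has maximal degree, and every degree occurring at height
`i + 1` is at most every degree occurring at height `i`. -/
def IsGreedyTree [Fintype V] (T : SimpleGraph V) (r : V) : Prop :=
  IsLevelGreedy T r ∧ (∀ v, deg T v ≤ deg T r) ∧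
    (∀ u v : V, T.dist r u = T.dist r v + 1 → deg T u ≤ deg T v)

/-- A subset of at least as many elements that dominates its complement has the larger sum,
even when compared across two families with the same multiset of values. -/
lemma sum_le_sum_of_dominating {α β : Type*} {S A : Finset α} {S' B : Finset β}
    {f : α → ℕ} {g : β → ℕ} (hfg : S.val.map f = S'.val.map g)
    (hA : A ⊆ S) (hB : B ⊆ S') (hcard : A.card ≤ B.card)
    (hdom : ∀ x ∈ S', x ∉ B → ∀ b ∈ B, g x ≤ g b) {φ : ℕ → ℕ} (hφ : Monotone φ) :
    ∑ a ∈ A, φ (f a) ≤ ∑ b ∈ B, φ (g b) := by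
  classical
  have key : ∀ ψ : ℕ → ℕ, ∑ x ∈ S, ψ (f x) = ∑ y ∈ S', ψ (g y) := fun ψ => by
    have := congrArg (fun m => (m.map ψ).sum) hfg
    simp only [Multiset.map_map] at this
    exact this
  by_cases hne : (S' \ B).Nonempty
  · obtain ⟨y, hy, hmax⟩ := Finset.exists_max_image (S' \ B) (fun x => φ (g x)) hne
    rw [Finset.mem_sdiff] at hy
    set θ := φ (g y)
    have hBθ : ∀ b ∈ B, θ ≤ φ (g b) := fun b hb => hφ (hdom y hy.1 hy.2 b hb)
    calc ∑ a ∈ A, φ (f a) ≤ ∑ a ∈ A, ((φ (f a) - θ) + θ) :=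
          Finset.sum_le_sum fun a _ => by omega
      _ = ∑ a ∈ A, (φ (f a) - θ) + A.card * θ := by simp [Finset.sum_add_distrib]
      _ ≤ ∑ a ∈ S, (φ (f a) - θ) + B.card * θ := by gcongr
      _ = ∑ b ∈ S', (φ (g b) - θ) + B.card * θ := by rw [key fun d => φ d - θ]
      _ = ∑ b ∈ B, (φ (g b) - θ) + B.card * θ := by
          congr 1
          refine (Finset.sum_subset hB fun x hx hxB => ?_).symm
          have := hmax x (Finset.mem_sdiff.2 ⟨hx, hxB⟩)
          omega
      _ = ∑ b ∈ B, ((φ (g b) - θ) + θ) := by simp [Finset.sum_add_distrib]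
      _ = ∑ b ∈ B, φ (g b) := Finset.sum_congr rfl fun b hb => by have := hBθ b hb; omega
  · have hBS : B = S' := hB.antisymm (by
      simpa [Finset.not_nonempty_iff_eq_empty, Finset.sdiff_eq_empty_iff_subset] using hne)
    rw [hBS, ← key]
    exact Finset.sum_le_sum_of_subset hA

section Rooted

variable {T : SimpleGraph V} {r : V}

open Classical in
/-- The parent of `v` in the tree `T` rooted at `r` (the root is its own parent). -/
noncomputable def par (T : SimpleGraph V) (r v : V) : V :=
  if h : ∃ w, T.Adj w v ∧ T.dist r v = T.dist r w + 1 then h.choose else v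

/-- The ancestor of `v` at height `t`. -/
noncomputable def anc (T : SimpleGraph V) (r : V) (t : ℕ) (v : V) : V :=
  (par T r)^[T.dist r v - t] v

open Classical in
/-- The descendants of `a` at height `j`. -/
noncomputable def desc [Fintype V] (T : SimpleGraph V) (r a : V) (j : ℕ) : Finset V :=
  Finset.univ.filter (fun v => T.dist r v = j ∧ anc T r (T.dist r a) v = a)

lemma mem_desc [Fintype V] {a v : V} {j : ℕ} :
    v ∈ desc T r a j ↔ T.dist r v = j ∧ anc T r (T.dist r a) v = a := by
  simp [desc]

lemma par_spec (hT : T.IsTree) {v : V} (hv : 0 < T.dist r v) :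
    T.Adj (par T r v) v ∧ T.dist r v = T.dist r (par T r v) + 1 := by
  have h : ∃ w, T.Adj w v ∧ T.dist r v = T.dist r w + 1 := by
    obtain ⟨p, hp⟩ := hT.connected.exists_walk_length_eq_dist v r
    cases p with
    | nil => simp at hv
    | cons h q =>
      rename_i w
      refine ⟨w, h.symm, ?_⟩
      have h1 := T.dist_le q
      have h2 := hT.dist_eq_dist_add_one_of_adj r h
      rw [Walk.length_cons, T.dist_comm] at hp
      rw [T.dist_comm] at h1
      omega
  rw [par, dif_pos h]
  exact h.choose_spec

lemma eq_of_adj_of_dist (hT : T.IsTree) {v w w' : V} (h : T.Adj w v)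
    (hd : T.dist r v = T.dist r w + 1) (h' : T.Adj w' v)
    (hd' : T.dist r v = T.dist r w' + 1) : w = w' := by
  obtain ⟨p, hp⟩ := hT.connected.exists_walk_length_eq_dist r w
  obtain ⟨q, hq⟩ := hT.connected.exists_walk_length_eq_dist r w'
  have h1 : (p.concat h).IsPath :=
    Walk.isPath_of_length_eq_dist _ (by rw [Walk.length_concat, hp, hd])
  have h2 : (q.concat h').IsPath :=
    Walk.isPath_of_length_eq_dist _ (by rw [Walk.length_concat, hq, hd'])
  have h3 := (hT.existsUnique_path r v).unique h1 h2
  simpa using congrArg Walk.penultimate h3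

lemma par_eq (hT : T.IsTree) {v w : V} (h : T.Adj w v)
    (hd : T.dist r v = T.dist r w + 1) : par T r v = w :=
  have hs := par_spec hT (r := r) (v := v) (by omega)
  eq_of_adj_of_dist hT hs.1 hs.2 h hd

lemma anc_self (v : V) : anc T r (T.dist r v) v = v := by simp [anc]

lemma anc_par (hT : T.IsTree) {t : ℕ} {v : V} (h : t < T.dist r v) :
    anc T r t (par T r v) = anc T r t v := by
  have hs := par_spec hT (r := r) (v := v) (by omega)
  have he : T.dist r v - t = (T.dist r (par T r v) - t) + 1 := by omega
  rw [anc, anc, he, Function.iterate_succ_apply]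

lemma dist_iterate_par (hT : T.IsTree) (n : ℕ) {v : V} (h : n ≤ T.dist r v) :
    T.dist r ((par T r)^[n] v) = T.dist r v - n ∧ T.dist v ((par T r)^[n] v) ≤ n := by
  induction n with
  | zero => simp
  | succ n ih =>
    obtain ⟨h1, h2⟩ := ih (by omega)
    rw [Function.iterate_succ_apply']
    have hs := par_spec hT (r := r) (v := (par T r)^[n] v) (by omega)
    have h3 := hT.connected.dist_triangle (u := v) (v := (par T r)^[n] v)
      (w := par T r ((par T r)^[n] v))
    have h4 := dist_eq_one_iff_adj.2 hs.1.symm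
    omega

lemma dist_anc (hT : T.IsTree) {t : ℕ} {v : V} (h : t ≤ T.dist r v) :
    T.dist r (anc T r t v) = t := by
  rw [anc, (dist_iterate_par hT _ (by omega)).1]
  omega

lemma dist_self_anc_le (hT : T.IsTree) {t : ℕ} {v : V} :
    T.dist v (anc T r t v) ≤ T.dist r v - t :=
  (dist_iterate_par hT _ (by omega)).2

lemma anc_anc (hT : T.IsTree) {s t : ℕ} {v : V} (hst : s ≤ t) (h : t ≤ T.dist r v) :
    anc T r s (anc T r t v) = anc T r s v := by
  have he : T.dist r v - s = (t - s) + (T.dist r v - t) := by omega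
  rw [anc, dist_anc hT h, anc, anc, he, Function.iterate_add_apply]

lemma eq_root_of_dist_eq_zero (hT : T.IsTree) {v : V} (h : T.dist r v = 0) : v = r :=
  (hT.connected.dist_eq_zero_iff.1 h).symm

/-- Vertices with a common ancestor at height `t` are close to each other. -/
lemma dist_le_of_anc_eq (hT : T.IsTree) {t : ℕ} {u v : V}
    (h : anc T r t u = anc T r t v) :
    T.dist u v ≤ (T.dist r u - t) + (T.dist r v - t) := by
  have h1 := dist_self_anc_le hT (r := r) (t := t) (v := u)
  have h2 := dist_self_anc_le hT (r := r) (t := t) (v := v)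
  have h3 := hT.connected.dist_triangle (u := u) (v := anc T r t u) (w := v)
  rw [h, T.dist_comm (u := anc T r t v)] at h3
  rw [h] at h1
  omega

/-- A walk leaving the subtree of an ancestor at height `t` is long. -/
lemma le_length_of_anc_ne (hT : T.IsTree) {t : ℕ} {u v : V} (p : T.Walk u v)
    (hu : t ≤ T.dist r u) (hv : t ≤ T.dist r v) (h : anc T r t u ≠ anc T r t v) :
    T.dist r u + T.dist r v + 2 ≤ p.length + 2 * t := by
  induction p with
  | nil => exact absurd rfl h
  | @cons u w v hadj q ih =>
    rw [Walk.length_cons]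
    rcases hT.dist_eq_dist_add_one_of_adj r hadj with hd | hd
    · have hpar := par_eq hT hadj.symm hd
      rcases hu.lt_or_eq with hlt | heq
      · have hanc := anc_par hT hlt
        rw [hpar] at hanc
        have := ih (by omega) hv (by rwa [hanc])
        omega
      · have h1 := T.dist_le q
        have h2 := hT.connected.dist_triangle (u := r) (v := w) (w := v)
        omega
    · have hpar := par_eq hT hadj hd
      have hanc := anc_par hT (r := r) (t := t) (v := w) (by omega)
      rw [hpar] at hanc
      have := ih (by omega) hv (by rwa [← hanc])
      omega

lemma le_dist_of_anc_ne (hT : T.IsTree) {t : ℕ} {u v : V}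
    (hu : t ≤ T.dist r u) (hv : t ≤ T.dist r v) (h : anc T r t u ≠ anc T r t v) :
    T.dist r u + T.dist r v + 2 ≤ T.dist u v + 2 * t := by
  obtain ⟨p, hp⟩ := hT.connected.exists_walk_length_eq_dist u v
  rw [← hp]
  exact le_length_of_anc_ne hT p hu hv h

variable [Fintype V]

/-- The down-degree of a vertex of degree `d` at height `j`. -/
def downDeg (j d : ℕ) : ℕ := if j = 0 then d else d - 1

lemma downDeg_mono (j : ℕ) : Monotone (downDeg j) := by
  intro a b h
  unfold downDeg
  split_ifs <;> omega

open Classical in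
lemma card_children (hT : T.IsTree) (p : V) :
    (Finset.univ.filter fun v => 0 < T.dist r v ∧ par T r v = p).card
      = downDeg (T.dist r p) (deg T p) := by
  have hsub : (Finset.univ.filter fun v => 0 < T.dist r v ∧ par T r v = p)
      = (Finset.univ.filter fun v => T.Adj p v).filter
          (fun v => T.dist r v = T.dist r p + 1) := by
    ext v
    simp only [Finset.mem_filter, Finset.mem_univ, true_and]
    constructor
    · rintro ⟨hv, rfl⟩
      exact par_spec hT hv
    · rintro ⟨h1, h2⟩
      exact ⟨by omega, par_eq hT h1 h2⟩
  rw [hsub, downDeg, deg]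
  split_ifs with h0
  · congr 1
    refine Finset.filter_true_of_mem fun v hv => ?_
    have := hT.dist_eq_dist_add_one_of_adj r (Finset.mem_filter.1 hv).2
    omega
  · have hs := par_spec hT (r := r) (v := p) (by omega)
    rw [← Finset.card_erase_of_mem (a := par T r p) (by simpa using hs.1.symm)]
    congr 1
    ext v
    simp only [Finset.mem_filter, Finset.mem_univ, true_and, Finset.mem_erase]
    constructor
    · rintro ⟨h1, h2⟩
      exact ⟨by rintro rfl; omega, h1⟩
    · rintro ⟨h1, h2⟩
      refine ⟨h2, ?_⟩
      rcases hT.dist_eq_dist_add_one_of_adj r h2 with h3 | h3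
      · exact absurd (par_eq hT h2.symm h3).symm h1
      · exact h3

lemma mem_desc_succ (hT : T.IsTree) {a v : V} {j : ℕ} (hj : T.dist r a ≤ j) :
    v ∈ desc T r a (j + 1) ↔ 0 < T.dist r v ∧ par T r v ∈ desc T r a j := by
  simp only [mem_desc]
  constructor
  · rintro ⟨h1, h2⟩
    have hs := par_spec hT (r := r) (v := v) (by omega)
    exact ⟨by omega, by omega, by rwa [anc_par hT (by omega)]⟩
  · rintro ⟨h0, h1, h2⟩
    have hs := par_spec hT h0
    exact ⟨by omega, by rwa [anc_par hT (by omega)] at h2⟩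

lemma card_desc_succ (hT : T.IsTree) {a : V} {j : ℕ} (hj : T.dist r a ≤ j) :
    (desc T r a (j + 1)).card = ∑ p ∈ desc T r a j, downDeg j (deg T p) := by
  classical
  rw [Finset.card_eq_sum_card_fiberwise (f := par T r) (t := desc T r a j)
    fun v hv => ((mem_desc_succ hT hj).1 hv).2]
  refine Finset.sum_congr rfl fun p hp => ?_
  rw [← (mem_desc.1 hp).1, ← card_children hT p]
  congr 1
  ext v
  simp only [Finset.mem_filter, Finset.mem_univ, true_and, mem_desc.1 hp, mem_desc_succ hT hj]
  constructor
  · rintro ⟨⟨h1, -⟩, h2⟩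
    exact ⟨h1, h2⟩
  · rintro ⟨h1, h2⟩
    exact ⟨⟨h1, h2 ▸ hp⟩, h2⟩

lemma desc_dist_self (a : V) : desc T r a (T.dist r a) = {a} := by
  ext v
  rw [mem_desc, Finset.mem_singleton]
  constructor
  · rintro ⟨h1, h2⟩
    rwa [← h1, anc_self] at h2
  · rintro rfl
    exact ⟨rfl, anc_self v⟩

lemma dist_le_ecc_s7 (u v : V) : T.dist u v ≤ ecc T u :=
  Finset.le_sup (f := fun v => T.dist u v) (Finset.mem_univ v)

/-- If the eccentricity of `u` is at most `k`, then `u` and any `v` share their ancestors at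
every height up to about `(h(u) + h(v) - k) / 2`. -/
lemma anc_eq_of_ecc_le (hT : T.IsTree) {k : ℕ} {u : V} (hu : ecc T u ≤ k) (v : V) :
    (T.dist r u + T.dist r v - k + 1) / 2 ≤ T.dist r u ∧
    (T.dist r u + T.dist r v - k + 1) / 2 ≤ T.dist r v ∧
    anc T r ((T.dist r u + T.dist r v - k + 1) / 2) u
      = anc T r ((T.dist r u + T.dist r v - k + 1) / 2) v := by
  have h1 := dist_le_ecc_s7 (T := T) u r
  have h2 := dist_le_ecc_s7 (T := T) u v
  have h3 := hT.connected.dist_triangle (u := r) (v := u) (w := v)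
  rw [T.dist_comm] at h1
  have hu' : (T.dist r u + T.dist r v - k + 1) / 2 ≤ T.dist r u := by omega
  have hv' : (T.dist r u + T.dist r v - k + 1) / 2 ≤ T.dist r v := by omega
  refine ⟨hu', hv', ?_⟩
  by_contra hne
  have h4 := le_dist_of_anc_ne hT hu' hv' hne
  by_cases hk : T.dist r u + T.dist r v ≤ k
  · have h0 : (T.dist r u + T.dist r v - k + 1) / 2 = 0 := by omega
    rw [h0] at hne
    exact hne ((eq_root_of_dist_eq_zero hT (dist_anc hT (Nat.zero_le _))).trans
      (eq_root_of_dist_eq_zero hT (dist_anc hT (Nat.zero_le _))).symm)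
  · omega

/-- `deg / ecc` as a nonnegative combination of the indicators of `ecc ≤ k`. -/
lemma deg_div_ecc_eq {N : ℕ} {u : V} (hN : ecc T u ≤ N) :
    (deg T u : ℝ) / ecc T u = (deg T u : ℝ) / (N + 1)
      + ∑ k ∈ Finset.range (N + 1),
          (1 / ((k : ℝ) * (k + 1))) * (if ecc T u ≤ k then (deg T u : ℝ) else 0) := by
  by_cases hd : deg T u = 0
  · simp [hd]
  have hpos : 0 < ecc T u := by
    classical
    obtain ⟨v, hv⟩ := Finset.card_pos.1 (Nat.pos_of_ne_zero hd)
    have := dist_eq_one_iff_adj.2 (Finset.mem_filter.1 hv).2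
    have := dist_le_ecc_s7 (T := T) u v
    omega
  induction N, hN using Nat.le_induction with
  | base =>
    rw [Finset.sum_range_succ, Finset.sum_eq_zero]
    · have : (ecc T u : ℝ) ≠ 0 := by positivity
      rw [if_pos le_rfl]
      field_simp
      ring
    · intro k hk
      rw [if_neg (by have := Finset.mem_range.1 hk; omega), mul_zero]
  | succ N hN ih =>
    rw [Finset.sum_range_succ, ih, if_pos (by omega)]
    have : (N : ℝ) + 1 ≠ 0 := by positivity
    have : (N : ℝ) + 1 + 1 ≠ 0 := by positivity
    push_cast
    field_simp
    ring

lemma cei_eq {N : ℕ} (hN : ∀ u, ecc T u ≤ N) :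
    cei T = ((∑ u ∈ Finset.univ.filter (fun u => ecc T u ≤ N), deg T u : ℕ) : ℝ) / (N + 1)
      + ∑ k ∈ Finset.range (N + 1), (1 / ((k : ℝ) * (k + 1))) *
          ((∑ u ∈ Finset.univ.filter (fun u => ecc T u ≤ k), deg T u : ℕ) : ℝ) := by
  rw [cei, Finset.sum_congr rfl fun u _ => deg_div_ecc_eq (hN u), Finset.sum_add_distrib,
    Finset.sum_comm, Finset.filter_true_of_mem fun u _ => hN u, ← Finset.sum_div]
  push_cast
  congr 1
  refine Finset.sum_congr rfl fun k _ => ?_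
  rw [← Finset.mul_sum, Finset.sum_filter]

end Rooted

section Comparison

variable {W : Type*} [Fintype V] [Fintype W] {L : ℕ → Multiset ℕ}
  {T : SimpleGraph V} {r : V} {S : SimpleGraph W} {s : W}

lemma hasLevelDegSeq.exists_dist_eq (hL : hasLevelDegSeq T r L) (hL' : hasLevelDegSeq S s L)
    (v : V) : ∃ w, S.dist s w = T.dist r v := by
  have h := congrArg Multiset.card ((hL (T.dist r v)).symm.trans (hL' (T.dist r v)))
  simp only [Multiset.card_map, Finset.card_val] at h
  have hpos : 0 < (Finset.univ.filter (fun w => S.dist s w = T.dist r v)).card := by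
    rw [← h]
    exact Finset.card_pos.2 ⟨v, by simp⟩
  obtain ⟨w, hw⟩ := Finset.card_pos.1 hpos
  exact ⟨w, (Finset.mem_filter.1 hw).2⟩

/-- In a level-greedy tree, every nonempty level `t` has a (leftmost) vertex whose descendants on
each level are of dominating degree and at least as numerous as the descendants of any vertex at
height `t` in any tree with the same level-degree sequence. -/
lemma IsLevelGreedy.exists_dominating (hT : T.IsTree) (hL : hasLevelDegSeq T r L)
    (hS : S.IsTree) (hL' : hasLevelDegSeq S s L) (hg : IsLevelGreedy S s) (a : V) :
    ∃ b, S.dist s b = T.dist r a ∧ ∀ j, T.dist r a ≤ j →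
      (desc T r a j).card ≤ (desc S s b j).card ∧
      ∀ x, S.dist s x = j → x ∉ desc S s b j → ∀ y ∈ desc S s b j, deg S x ≤ deg S y := by
  obtain ⟨ord, hinj, hdeg, hch⟩ := hg
  obtain ⟨w, hw⟩ := hL.exists_dist_eq hL' a
  obtain ⟨b, hb, hmin⟩ := Finset.exists_min_image
    (Finset.univ.filter (fun x => S.dist s x = T.dist r a)) ord ⟨w, by simpa using hw⟩
  replace hb : S.dist s b = T.dist r a := (Finset.mem_filter.1 hb).2
  have hprefix : ∀ j, T.dist r a ≤ j → ∀ y ∈ desc S s b j, ∀ x, S.dist s x = j →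
      ord x ≤ ord y → x ∈ desc S s b j := by
    intro j hj
    induction j, hj using Nat.le_induction with
    | base =>
      intro y hy x hx hxy
      rw [← hb, desc_dist_self, Finset.mem_singleton] at hy ⊢
      subst hy
      exact hinj _ _ (by omega) (hxy.antisymm (hmin x (by simpa using hx)))
    | succ j hj ih =>
      intro y hy x hx hxy
      rw [mem_desc_succ hS (by omega)] at hy ⊢
      have hx0 : 0 < S.dist s x := by omega
      refine ⟨hx0, ?_⟩
      have hpx := par_spec hS hx0
      have hpy := par_spec hS hy.1
      have hyj := (mem_desc.1 hy.2).1
      refine ih _ hy.2 _ (by omega) ?_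
      by_contra! hlt
      have := hch _ _ y x (by omega) hpy.1 hpy.2 hpx.1 hpx.2 hlt
      omega
  have hdom : ∀ j, T.dist r a ≤ j →
      ∀ x, S.dist s x = j → x ∉ desc S s b j → ∀ y ∈ desc S s b j, deg S x ≤ deg S y := by
    intro j hj x hx hxn y hy
    have hyj := (mem_desc.1 hy).1
    refine hdeg y x (by omega) ?_
    by_contra! hlt
    exact hxn (hprefix j hj y hy x hx hlt.le)
  refine ⟨b, hb, fun j hj => ⟨?_, hdom j hj⟩⟩
  induction j, hj using Nat.le_induction with
  | base => rw [desc_dist_self, ← hb, desc_dist_self]; simp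
  | succ j hj ih =>
    rw [card_desc_succ hT hj, card_desc_succ hS (by omega)]
    refine sum_le_sum_of_dominating ((hL j).symm.trans (hL' j)) ?_ ?_ ih ?_ (downDeg_mono j)
    · intro v hv
      simpa using (mem_desc.1 hv).1
    · intro v hv
      simpa using (mem_desc.1 hv).1
    · intro x hx
      exact hdom j hj x (Finset.mem_filter.1 hx).2

/-- On each level, the total degree of the vertices of eccentricity at most `k` is largest in the
level-greedy tree. -/
lemma sum_deg_level_le (hT : T.IsTree) (hL : hasLevelDegSeq T r L)
    (hS : S.IsTree) (hL' : hasLevelDegSeq S s L) (hg : IsLevelGreedy S s) (k i : ℕ) :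
    ∑ u ∈ Finset.univ.filter (fun u => T.dist r u = i ∧ ecc T u ≤ k), deg T u
      ≤ ∑ u ∈ Finset.univ.filter (fun u => S.dist s u = i ∧ ecc S u ≤ k), deg S u := by
  set A := Finset.univ.filter (fun u => T.dist r u = i ∧ ecc T u ≤ k)
  rcases A.eq_empty_or_nonempty with hA | ⟨u₀, hu₀⟩
  · simp [hA]
  obtain ⟨hi, hk⟩ : T.dist r u₀ = i ∧ ecc T u₀ ≤ k := by simpa [A] using hu₀
  choose b hb hb' using fun a => hg.exists_dominating hT hL hS hL' a
  obtain ⟨z, -, hz⟩ := Finset.exists_max_image Finset.univ (fun v => T.dist r v) ⟨r, by simp⟩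
  obtain ⟨z', hz'⟩ := hL.exists_dist_eq hL' z
  let τ : ℕ → ℕ := fun m => (i + m - k + 1) / 2
  let a : ℕ → V := fun m => anc T r (τ m) u₀
  have hτ : ∀ v : V, τ (T.dist r v) ≤ i ∧ τ (T.dist r v) ≤ T.dist r v ∧
      a (T.dist r v) = anc T r (τ (T.dist r v)) v := by
    intro v
    have := anc_eq_of_ecc_le hT (r := r) hk v
    rwa [hi] at this
  have ha : ∀ v : V, T.dist r (a (T.dist r v)) = τ (T.dist r v) := fun v =>
    dist_anc hT (by rw [hi]; exact (hτ v).1)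
  have hfull : ∀ (v : V) (w : W), S.dist s w = T.dist r v →
      anc S s (τ (T.dist r v)) w = b (a (T.dist r v)) := by
    intro v w hw
    set m := T.dist r v with hm
    have hlevel : desc T r (a m) m = Finset.univ.filter (fun x => T.dist r x = m) := by
      ext x
      rw [mem_desc, Finset.mem_filter, hm, ha v]
      constructor
      · rintro ⟨h, -⟩
        exact ⟨Finset.mem_univ _, h⟩
      · rintro ⟨-, h⟩
        refine ⟨h, ?_⟩
        have := (hτ x).2.2
        rw [h] at this
        exact this.symm
    have hc := (hb' (a m) m (by rw [hm, ha v]; exact (hτ v).2.1)).1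
    have hcard := congrArg Multiset.card ((hL m).symm.trans (hL' m))
    simp only [Multiset.card_map, Finset.card_val] at hcard
    rw [hlevel, hcard] at hc
    have heq := Finset.eq_of_subset_of_card_le (fun x hx => by
      simpa using (mem_desc.1 hx).1) hc
    have hw' : w ∈ desc S s (b (a m)) m := by
      rw [heq]
      simpa using hw
    have := (mem_desc.1 hw').2
    rwa [hb, hm, ha v] at this
  obtain ⟨hcard, hdom⟩ := hb' (a (T.dist r z)) i (by rw [ha z]; exact (hτ z).1)
  have hAsub : A ⊆ desc T r (a (T.dist r z)) i := by
    intro u hu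
    obtain ⟨hui, huk⟩ : T.dist r u = i ∧ ecc T u ≤ k := by simpa [A] using hu
    rw [mem_desc, ha z, (hτ z).2.2]
    refine ⟨hui, ?_⟩
    have := (anc_eq_of_ecc_le hT (r := r) huk z).2.2
    rwa [hui] at this
  calc ∑ u ∈ A, deg T u ≤ ∑ u ∈ desc S s (b (a (T.dist r z))) i, deg S u := by
        refine sum_le_sum_of_dominating (φ := id) ((hL i).symm.trans (hL' i)) ?_ ?_
          ((Finset.card_le_card hAsub).trans hcard) ?_ monotone_id
        · intro u hu
          have : T.dist r u = i ∧ ecc T u ≤ k := by simpa [A] using hu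
          simpa using this.1
        · intro u hu
          simpa using (mem_desc.1 hu).1
        · intro x hx
          exact hdom x (Finset.mem_filter.1 hx).2
    _ ≤ _ := by
        refine Finset.sum_le_sum_of_subset fun u hu => ?_
        obtain ⟨hui, hua⟩ := mem_desc.1 hu
        rw [hb, ha z] at hua
        rw [Finset.mem_filter]
        refine ⟨Finset.mem_univ _, hui, Finset.sup_le fun w _ => ?_⟩
        obtain ⟨v, hv⟩ := hL'.exists_dist_eq hL w
        have hvz := hz v (Finset.mem_univ _)
        have hmono : τ (T.dist r v) ≤ τ (T.dist r z) := by simp only [τ]; omega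
        have h1 := hfull v w hv.symm
        have h2 : anc S s (τ (T.dist r v)) u = b (a (T.dist r v)) := by
          have h3 := hfull v (anc S s (T.dist r v) z') (dist_anc hS (by omega))
          rw [anc_anc hS (hτ v).2.1 (by omega)] at h3
          rw [← anc_anc hS hmono (by rw [hui]; exact (hτ z).1), hua, ← hfull z z' hz',
            anc_anc hS hmono (by rw [hz']; exact (hτ z).2.1), h3]
        have h4 := dist_le_of_anc_eq hS (h2.trans h1.symm)
        have h5 := hτ v
        simp only [τ] at h4 h5
        omega

lemma sum_deg_ecc_le (hT : T.IsTree) (hL : hasLevelDegSeq T r L)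
    (hS : S.IsTree) (hL' : hasLevelDegSeq S s L) (hg : IsLevelGreedy S s) (k : ℕ) :
    ∑ u ∈ Finset.univ.filter (fun u => ecc T u ≤ k), deg T u
      ≤ ∑ u ∈ Finset.univ.filter (fun u => ecc S u ≤ k), deg S u := by
  let M := ecc T r + ecc S s + 1
  rw [← Finset.sum_fiberwise_of_maps_to (t := Finset.range M) (g := fun u => T.dist r u),
    ← Finset.sum_fiberwise_of_maps_to (t := Finset.range M) (g := fun u => S.dist s u)]
  · refine Finset.sum_le_sum fun i _ => ?_
    have := sum_deg_level_le hT hL hS hL' hg k i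
    simpa only [Finset.filter_filter, and_comm] using this
  · intro u _
    have := dist_le_ecc_s7 (T := S) s u
    exact Finset.mem_range.2 (by omega)
  · intro u _
    have := dist_le_ecc_s7 (T := T) r u
    exact Finset.mem_range.2 (by omega)

end Comparison

/-- among all rooted trees with a given level-degree sequence, the
level-greedy rooted tree maximizes the connective eccentricity index. -/
theorem cei_levelGreedy_max {W : Type*} [Fintype V] [Fintype W]
    (L : ℕ → Multiset ℕ)
    (T : SimpleGraph V) (r : V) (hT : T.IsTree) (hL : hasLevelDegSeq T r L)
    (Tstar : SimpleGraph W) (rstar : W) (hTstar : Tstar.IsTree)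
    (hLstar : hasLevelDegSeq Tstar rstar L)
    (hgreedy : IsLevelGreedy Tstar rstar) :
    cei T ≤ cei Tstar := by
  let N := Finset.univ.sup (ecc T) + Finset.univ.sup (ecc Tstar)
  have hN : ∀ u, ecc T u ≤ N := fun u =>
    (Finset.le_sup (Finset.mem_univ u)).trans (Nat.le_add_right _ _)
  have hN' : ∀ u, ecc Tstar u ≤ N := fun u =>
    (Finset.le_sup (Finset.mem_univ u)).trans (Nat.le_add_left _ _)
  rw [cei_eq hN, cei_eq hN']
  have key := sum_deg_ecc_le hT hL hTstar hLstar hgreedy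
  gcongr
  · exact key N
  · exact key _
end
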